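/- arXiv:2202.08254 — 6 statements merged into one kernel-verified Lean document; each statement's English description precedes it below -/
import Mathlib

section
/- (Non-autonomous subadditive theorem, almost-sure version.) Assume hypotheses (1)-(4) and (6) on the family X_{m,n}^t, and assume that for some α > 0 one has lim_{s→∞} s^α φ(s) = 0. Then the limit L := lim_{n→∞} E[X_{0,n}^0]/n exists and, for almost every ω ∈ Ω, lim_{n→∞} X_{0,n}^0(ω)/n = L. -/
open MeasureTheory Filter

theorem aux_summable (V β e : ℕ → ℝ) (hV : ∀ k, 0 ≤ V k) (hβ : ∀ k, 0 ≤ β k)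
    (he : Summable e) (he0 : ∀ k, 0 ≤ e k)
    (h : ∀ k, V (k+1) ≤ V k / 2 + β k - β (k+1) + e k) : Summable V := by
  have key : ∀ K, ∑ k ∈ Finset.range K, V k + 2 * V K + 2 * β K
      ≤ 2 * V 0 + 2 * β 0 + 2 * ∑ k ∈ Finset.range K, e k := by
    intro K
    induction K with
    | zero => simp
    | succ K ih =>
      rw [Finset.sum_range_succ, Finset.sum_range_succ]
      have := h K
      linarith
  refine summable_of_sum_range_le (c := 2 * V 0 + 2 * β 0 + 2 * ∑' k, e k) hV ?_
  intro K
  have h1 := key K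
  have h2 := he.sum_le_tsum (Finset.range K) (fun i _ => he0 i)
  have := hV K
  have := hβ K
  linarith

theorem aux_limit (a φ : ℕ → ℝ) (D : ℝ) (hD : 0 ≤ D) (ha0 : ∀ n, 1 ≤ n → 0 ≤ a n)
    (ha : ∀ n, 1 ≤ n → a n ≤ D * n) (S : ℕ) (hφ : Tendsto φ atTop (nhds 0)) 
    (h : ∀ s, S ≤ s → ∀ m n, 1 ≤ m → 1 ≤ n → a (m+n) ≤ a m + a n + (s+2) + φ s * (D * n)) :
    ∃ L, Tendsto (fun n : ℕ => a n / n) atTop (nhds L) := by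
  have hb : ∀ s, S ≤ s → ∀ n, 1 ≤ n → ∀ N : ℕ, 1 ≤ N → 0 ≤ a n + (s+2) + φ s * (D*n) → 
      a N ≤ (N/n) * (a n + (s+2) + φ s * (D*n)) + D * n := by
    intro s hs n hn N
    induction N using Nat.strong_induction_on with
    | _ N ih =>
      intro hN hg
      have hn' : (0:ℝ) < n := by exact_mod_cast hn
      by_cases hc : N ≤ n
      · have h1 := ha N hN
        have h2 : D * N ≤ D * n := by gcongr
        have h3 : 0 ≤ ((N:ℝ)/n) * (a n + (s+2) + φ s * (D*n)) := by positivity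
        linarith
      · push Not at hc
        obtain ⟨m, rfl⟩ := Nat.exists_eq_add_of_lt hc
        have h1 := ih (m+1) (by omega) (by omega) hg
        have h2 := h s hs (m+1) n (by omega) hn
        have e1 : n + m + 1 = m + 1 + n := by ring
        rw [e1]
        have e2 : (((m + 1 + n : ℕ):ℝ)/n) = ((m+1:ℕ):ℝ)/n + 1 := by
          push_cast; field_simp
        rw [e2]
        linarith
  set b : ℕ → ℝ := fun n => a n / n with hbdef
  have hbdd : ∀ᶠ n in atTop, b n ≤ D := by
    filter_upwards [eventually_ge_atTop 1] with n hn
    have hn' : (0:ℝ) < n := by exact_mod_cast hn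
    rw [hbdef]; simp only
    rw [div_le_iff₀ hn']; exact ha n hn
  have hb0 : ∀ᶠ n in atTop, 0 ≤ b n := by
    filter_upwards [eventually_ge_atTop 1] with n hn
    have := ha0 n hn
    positivity
  have hB1 : IsBoundedUnder (· ≤ ·) atTop b := ⟨D, by simpa using hbdd⟩
  have hB2 : IsBoundedUnder (· ≥ ·) atTop b := ⟨0, by simpa using hb0⟩
  refine ⟨liminf b atTop, ?_⟩
  rw [tendsto_order]
  refine ⟨fun x hx => eventually_lt_of_lt_liminf hx hB2, fun x hx => ?_⟩
  set L := liminf b atTop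
  obtain ⟨ε, hε, rfl⟩ : ∃ ε, 0 < ε ∧ x = L + 4 * ε := ⟨(x - L)/4, by linarith, by ring⟩
  have hs : ∃ s, S ≤ s ∧ |φ s| * D < ε := by
    have : Tendsto (fun s => |φ s| * D) atTop (nhds 0) := by simpa using hφ.abs.mul_const D
    exact ((eventually_ge_atTop S).and (this.eventually_lt_const hε)).exists
  obtain ⟨s, hs, hsφ⟩ := hs
  have hfreq : ∃ᶠ n in atTop, b n < L + ε := frequently_lt_of_liminf_lt hB1.isCoboundedUnder_ge (by linarith)
  have h3 : ∀ᶠ n : ℕ in atTop, ((s:ℝ)+2)/n < ε := 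
    (tendsto_const_div_atTop_nhds_zero_nat _).eventually_lt_const hε
  obtain ⟨n, hn1, hn2, hn3⟩ := (hfreq.and_eventually (h3.and (eventually_ge_atTop 1))).exists
  have hn' : (0:ℝ) < n := by exact_mod_cast hn3
  have hL : 0 ≤ L := le_liminf_of_le hB1.isCoboundedUnder_ge hb0
  have h4 : ∀ᶠ N : ℕ in atTop, (D*n)/N < ε := 
    (tendsto_const_div_atTop_nhds_zero_nat _).eventually_lt_const hε
  filter_upwards [h4, eventually_ge_atTop 1] with N hN4 hN
  have hN' : (0:ℝ) < N := by exact_mod_cast hN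
  have hg : a n + (s+2) + |φ s| * (D*n) < (L + 3*ε) * n := by
    have i1 : a n < (L+ε)*n := by rwa [hbdef, div_lt_iff₀ hn'] at hn1
    have i2 : (s:ℝ)+2 < ε * n := by rwa [div_lt_iff₀ hn'] at hn2
    have i3 : |φ s| * D * n < ε * n := by gcongr
    linarith
  have hle : φ s * (D*n) ≤ |φ s| * (D*n) := by gcongr; exact le_abs_self _
  have hg0 : 0 ≤ a n + (s+2) + φ s * (D*n) := by
    have h5 := h s hs n n hn3 hn3
    have := ha0 (n+n) (by omega)
    by_contra hcon
    push Not at hcon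
    -- iterate
    have it : ∀ k : ℕ, a (n + k * n) ≤ a n + k * (a n + (s+2) + φ s * (D*n)) := by
      intro k
      induction k with
      | zero => simp
      | succ k ih =>
        have := h s hs (n + k*n) n (by omega) hn3
        have e : n + (k+1)*n = n + k*n + n := by ring
        rw [e]; push_cast; linarith
    obtain ⟨k, hk⟩ := exists_nat_gt (a n / (-(a n + (s+2) + φ s * (D*n))))
    rw [div_lt_iff₀ (by linarith)] at hk
    have := it k
    have := ha0 (n + k*n) (by omega)
    linarith
  have hf := hb s hs n hn3 N hN hg0
  have : a n + (s+2) + φ s * (D*n) ≤ (L + 3*ε) * n := by linarith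
  rw [hbdef]; simp only
  rw [div_lt_iff₀ hN']
  rw [div_lt_iff₀ hN'] at hN4
  have h6 : (N/n:ℝ) * (a n + (s+2) + φ s * (D*n)) ≤ (N/n:ℝ) * ((L + 3*ε) * n) := by gcongr
  have h7 : (N/n:ℝ) * ((L + 3*ε) * n) = (L+3*ε)*N := by field_simp
  linarith

theorem aux_sandwich (x : ℕ → ℝ) (D L : ℝ) (hD : 0 ≤ D)
    (hx : ∀ n k, 1 ≤ n → 1 ≤ k → x (n+k) ≤ x n + D * k)
    (h : ∀ q : ℕ, 1 ≤ q → Tendsto (fun k : ℕ => x (q*2^k) / ((q*2^k : ℕ):ℝ)) atTop (nhds L)) :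
    Tendsto (fun n : ℕ => x n / n) atTop (nhds L) := by
  rw [Metric.tendsto_atTop]
  intro ε0 hε0
  obtain ⟨ε, hε, rfl⟩ : ∃ ε, 0 < ε ∧ ε0 = 4 * ε := ⟨ε0/4, by linarith, by ring⟩
  obtain ⟨r, hr⟩ : ∃ r : ℕ, (D + |L|) < ε * 2^r := by
    obtain ⟨r, hr⟩ := pow_unbounded_of_one_lt ((D+|L|)/ε) (one_lt_two)
    exact ⟨r, by rwa [div_lt_iff₀' hε] at hr⟩
  have hall : ∀ᶠ k : ℕ in atTop, ∀ q ∈ Finset.Icc 1 (2^(r+1)), |x (q*2^k) - L * (q*2^k : ℕ)| ≤ ε * (q*2^k:ℕ) := by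
    rw [Filter.eventually_all_finset]
    intro q hq
    have hq1 : 1 ≤ q := (Finset.mem_Icc.mp hq).1
    have := (Metric.tendsto_nhds.mp (h q hq1)) ε hε
    filter_upwards [this] with k hk
    have hpos : (0:ℝ) < ((q*2^k:ℕ):ℝ) := by exact_mod_cast (by positivity)
    rw [Real.dist_eq] at hk
    have e : x (q*2^k) - L * (q*2^k : ℕ) = (x (q*2^k) / (q*2^k : ℕ) - L) * (q*2^k : ℕ) := by field_simp
    rw [e, abs_mul, abs_of_pos hpos]
    gcongr
  obtain ⟨k0, hk0⟩ := eventually_atTop.mp hall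
  refine ⟨2^(r+k0), fun n hn => ?_⟩
  have hn1 : 1 ≤ n := le_trans Nat.one_le_two_pow hn
  have hn0 : n ≠ 0 := by omega
  have hlog : r + k0 ≤ Nat.log 2 n := (Nat.le_log_iff_pow_le one_lt_two hn0).mpr hn
  obtain ⟨k, hk⟩ := Nat.exists_eq_add_of_le (show r ≤ Nat.log 2 n by omega)
  have hlow : 2^(r+k) ≤ n := hk ▸ Nat.pow_log_le_self 2 hn0
  have hup : n < 2^(r+k+1) := hk ▸ Nat.lt_pow_succ_log_self one_lt_two n
  set q := n / 2^k with hq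
  have h2k : 0 < 2^k := by positivity
  have hq1 : 2^r ≤ q := by rw [hq, Nat.le_div_iff_mul_le h2k, ← pow_add]; exact hlow
  have hq2 : q < 2^(r+1) := by
    rw [hq, Nat.div_lt_iff_lt_mul h2k, ← pow_add]; convert hup using 2; ring
  have hqn : q * 2^k ≤ n := Nat.div_mul_le_self n _
  have hqn' : n < (q+1)*2^k := by
    have := Nat.lt_div_mul_add (a := n) h2k
    rw [add_mul, one_mul]; exact this
  have hq0 : 1 ≤ q := le_trans Nat.one_le_two_pow hq1
  have A1 := hk0 k (by omega) q (Finset.mem_Icc.mpr ⟨hq0, by omega⟩)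
  have A2 := hk0 k (by omega) (q+1) (Finset.mem_Icc.mpr ⟨by omega, by omega⟩)
  have hnpos : (0:ℝ) < n := by exact_mod_cast hn1
  have B1 : x n ≤ x (q*2^k) + D * 2^k := by
    rcases hqn.eq_or_lt with he | hl
    · rw [he]; have : 0 ≤ D * 2^k := by positivity
      linarith
    · have := hx (q*2^k) (n - q*2^k) (Nat.mul_pos hq0 h2k) (by omega)
      rw [Nat.add_sub_cancel' hqn] at this
      have h' : ((n - q*2^k : ℕ):ℝ) ≤ 2^k := by
        have : n - q*2^k ≤ 2^k := by rw [add_mul, one_mul] at hqn'; omega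
        exact_mod_cast this
      have : D * ((n - q*2^k : ℕ):ℝ) ≤ D * 2^k := by gcongr
      linarith
  have B2 : x ((q+1)*2^k) ≤ x n + D * 2^k := by
    have := hx n ((q+1)*2^k - n) hn1 (by omega)
    rw [Nat.add_sub_cancel' hqn'.le] at this
    have h' : (((q+1)*2^k - n : ℕ):ℝ) ≤ 2^k := by
      have : (q+1)*2^k - n ≤ 2^k := by rw [add_mul, one_mul] at *; omega
      exact_mod_cast this
    have : D * (((q+1)*2^k - n : ℕ):ℝ) ≤ D * 2^k := by gcongr
    linarith
  have C1 : ((q*2^k:ℕ):ℝ) ≤ n := by exact_mod_cast hqn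
  have C2 : (n:ℝ) ≤ (((q+1)*2^k:ℕ):ℝ) := by exact_mod_cast hqn'.le
  have C3 : (((q+1)*2^k:ℕ):ℝ) = ((q*2^k:ℕ):ℝ) + 2^k := by push_cast; ring
  have C4 : (2:ℝ)^k ≤ n := by
    have : 2^k ≤ n := le_trans (Nat.le_mul_of_pos_left _ hq0) hqn
    exact_mod_cast this
  have C5 : (D+|L|) * 2^k ≤ ε * n := by
    have : (2:ℝ)^r * 2^k ≤ n := by rw [← pow_add]; exact_mod_cast hlow
    calc (D+|L|) * 2^k ≤ (ε * 2^r) * 2^k := by gcongr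
      _ = ε * (2^r*2^k) := by ring
      _ ≤ ε * n := by gcongr
  have C6 : ∀ y : ℝ, |y| ≤ 2^k → |L * y| ≤ |L| * 2^k := by
    intro y hy; rw [abs_mul]; gcongr
  have D1 := abs_le.mp (C6 (((q*2^k:ℕ):ℝ) - n) (by rw [abs_le]; constructor <;> linarith))
  have D2 := abs_le.mp (C6 ((((q+1)*2^k:ℕ):ℝ) - n) (by rw [abs_le]; constructor <;> linarith))
  rw [abs_le] at A1 A2
  have E1 : ε * ((q*2^k:ℕ):ℝ) ≤ ε * n := by gcongr
  have E2 : ε * (((q+1)*2^k:ℕ):ℝ) ≤ ε * (2*n) := by gcongr; linarith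
  have hfin : |x n - L * n| ≤ 3 * ε * n := by
    rw [abs_le]; constructor <;> nlinarith [A1.1, A1.2, A2.1, A2.2, D1.1, D1.2, D2.1, D2.2]
  rw [Real.dist_eq]
  have e : x n / n - L = (x n - L * n)/n := by field_simp
  rw [e, abs_div, abs_of_pos hnpos, div_lt_iff₀ hnpos]
  nlinarith
theorem aux_mix {Ω : Type*} [m0 : MeasurableSpace Ω] (P : Measure Ω) [IsProbabilityMeasure P]
    (Fm Fp : ℝ → MeasurableSpace Ω)
    (φ : ℝ → ℝ)
    (hφ : ∀ s : ℝ, φ s = sSup {r | ∃ t : ℝ, 0 ≤ t ∧ ∃ Ev Fv : Set Ω,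
      MeasurableSet[Fm t] Ev ∧ MeasurableSet[Fp (t + s)] Fv ∧ 0 < P Ev ∧
      r = |(P (Fv ∩ Ev)).toReal / (P Ev).toReal - (P Fv).toReal|}) :
    (∀ s, 0 ≤ φ s) ∧ (∀ s, φ s ≤ 1) ∧
    ∀ s t, 0 ≤ t → ∀ Ev Fv : Set Ω, MeasurableSet[Fm t] Ev → MeasurableSet[Fp (t + s)] Fv →
      P (Fv ∩ Ev) ≤ P Ev * (P Fv + ENNReal.ofReal (φ s)) := by
  have hb : ∀ s, ∀ r ∈ {r | ∃ t : ℝ, 0 ≤ t ∧ ∃ Ev Fv : Set Ω,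
      MeasurableSet[Fm t] Ev ∧ MeasurableSet[Fp (t + s)] Fv ∧ 0 < P Ev ∧
      r = |(P (Fv ∩ Ev)).toReal / (P Ev).toReal - (P Fv).toReal|}, r ≤ 1 := by
    rintro s r ⟨t, ht, E, F, hE, hF, hpos, rfl⟩
    have h1 : (P (F ∩ E)).toReal ≤ (P E).toReal :=
      ENNReal.toReal_mono (measure_ne_top _ _) (measure_mono Set.inter_subset_right)
    have h0 : 0 < (P E).toReal := ENNReal.toReal_pos hpos.ne' (measure_ne_top _ _)
    have h2 : (P (F ∩ E)).toReal / (P E).toReal ≤ 1 := by rw [div_le_one h0]; exact h1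
    have h3 : 0 ≤ (P (F ∩ E)).toReal / (P E).toReal := by positivity
    have h4 : (P F).toReal ≤ 1 := by
      have := ENNReal.toReal_mono ENNReal.one_ne_top (prob_le_one (μ := P) (s := F))
      simpa using this
    have h5 : 0 ≤ (P F).toReal := ENNReal.toReal_nonneg
    rw [abs_le]; constructor <;> linarith
  refine ⟨fun s => ?_, fun s => ?_, fun s t ht E F hE hF => ?_⟩
  · rw [hφ]
    apply Real.sSup_nonneg
    rintro r ⟨t, ht, E, F, hE, hF, hpos, rfl⟩
    positivity
  · rw [hφ]
    exact Real.sSup_le (hb s) zero_le_one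
  · by_cases h0 : P E = 0
    · have : P (F ∩ E) ≤ P E := measure_mono Set.inter_subset_right
      rw [h0] at this
      rw [h0]; simpa using this
    · have hpos : 0 < P E := pos_iff_ne_zero.mpr h0
      have h1 : |(P (F ∩ E)).toReal / (P E).toReal - (P F).toReal| ≤ φ s := by
        rw [hφ]
        exact le_csSup ⟨1, hb s⟩ ⟨t, ht, E, F, hE, hF, hpos, rfl⟩
      have hE0 : 0 < (P E).toReal := ENNReal.toReal_pos h0 (measure_ne_top _ _)
      have h2 := (abs_le.mp h1).2
      have hφ0 : 0 ≤ φ s := le_trans (abs_nonneg _) h1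
      have h3 : (P (F ∩ E)).toReal ≤ (P E).toReal * ((P F).toReal + φ s) := by
        have : (P (F ∩ E)).toReal / (P E).toReal ≤ (P F).toReal + φ s := by linarith
        rwa [div_le_iff₀' hE0] at this
      rw [← ENNReal.ofReal_toReal (measure_ne_top P (F ∩ E)),
        ← ENNReal.ofReal_toReal (measure_ne_top P F), ← ENNReal.ofReal_toReal (measure_ne_top P E),
        ← ENNReal.ofReal_add ENNReal.toReal_nonneg hφ0, ← ENNReal.ofReal_mul ENNReal.toReal_nonneg]
      exact ENNReal.ofReal_le_ofReal h3

theorem aux_layer {Ω : Type*} (mp : MeasurableSpace Ω) [m0 : MeasurableSpace Ω] (P : Measure Ω)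
    [IsProbabilityMeasure P] (hmp : mp ≤ m0) (E : Set Ω) (hE : MeasurableSet E) (c : ENNReal)
    (H : ∀ F, MeasurableSet[mp] F → P (F ∩ E) ≤ P E * (P F + c))
    (Y : Ω → ℝ) (hY : Measurable[mp] Y) (hY0 : ∀ ω, 0 ≤ Y ω) (M : ℝ) (hYM : ∀ᵐ ω ∂P, Y ω ≤ M) :
    ∫⁻ ω in E, ENNReal.ofReal (Y ω) ∂P
      ≤ P E * (∫⁻ ω, ENNReal.ofReal (Y ω) ∂P + c * ENNReal.ofReal M) := by
  have hYm : Measurable Y := hY.mono hmp le_rfl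
  rw [lintegral_eq_lintegral_meas_lt _ (Eventually.of_forall hY0) hYm.aemeasurable,
    lintegral_eq_lintegral_meas_lt _ (Eventually.of_forall hY0) hYm.aemeasurable]
  have hsets : ∀ r, MeasurableSet[mp] {a | r < Y a} := fun r => 
    hY measurableSet_Ioi
  have hanti : Measurable fun r => P {a | r < Y a} := by
    apply Antitone.measurable
    intro r r' hr
    exact measure_mono fun a (ha : r' < Y a) => lt_of_le_of_lt hr ha
  calc ∫⁻ r in Set.Ioi (0:ℝ), (P.restrict E) {a | r < Y a}
      ≤ ∫⁻ r in Set.Ioi (0:ℝ), (P E * (P {a | r < Y a} + (Set.Iio M).indicator (fun _ => c) r)) := by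
        apply lintegral_mono
        intro r
        simp only
        rw [Measure.restrict_apply (hmp _ (hsets r))]
        by_cases hr : r < M
        · rw [Set.indicator_of_mem (by exact hr)]
          exact H _ (hsets r)
        · have : P {a | r < Y a} = 0 := by
            rw [← nonpos_iff_eq_zero]
            have : P {a | ¬ (Y a ≤ M)} = 0 := hYM
            rw [← this]
            apply measure_mono
            intro a (ha : r < Y a)
            simp only [Set.mem_ofPred_eq, not_le]
            push Not at hr
            exact lt_of_le_of_lt hr ha
          have h2 : P ({a | r < Y a} ∩ E) ≤ P {a | r < Y a} := measure_mono Set.inter_subset_left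
          rw [this] at h2
          exact le_trans h2 (zero_le)
    _ = P E * ((∫⁻ r in Set.Ioi (0:ℝ), P {a | r < Y a}) + c * ENNReal.ofReal M) := by
        have hme : Measurable fun r => P {a | r < Y a} + (Set.Iio M).indicator (fun _ => c) r :=
          hanti.add (measurable_const.indicator measurableSet_Iio)
        rw [lintegral_const_mul _ hme,
          lintegral_add_left hanti]
        congr 2
        rw [lintegral_indicator measurableSet_Iio, lintegral_const, Measure.restrict_restrict measurableSet_Iio,
          Measure.restrict_apply MeasurableSet.univ, Set.univ_inter, Set.Iio_inter_Ioi, Real.volume_Ioo, sub_zero]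

theorem aux_sum {Ω : Type*} [m0 : MeasurableSpace Ω] (P : Measure Ω) [IsProbabilityMeasure P]
    (J : Ω → ℕ) (hJ : Measurable J) (G : ℕ → Ω → ℝ) (hG : ∀ j, Measurable (G j))
    (hG0 : ∀ j ω, 0 ≤ G j ω) (A M c : ℝ) (hc : 0 ≤ c) (hM : 0 ≤ M) (hGM : ∀ j, ∀ᵐ ω ∂P, G j ω ≤ M)
    (hA : ∀ j, ∫ ω, G j ω ∂P = A)
    (H : ∀ j, ∫⁻ ω in J ⁻¹' {j}, ENNReal.ofReal (G j ω) ∂P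
      ≤ P (J ⁻¹' {j}) * (∫⁻ ω, ENNReal.ofReal (G j ω) ∂P + ENNReal.ofReal c * ENNReal.ofReal M))
    (g : ℕ → ℝ) (hg : ∀ j, 0 ≤ g j) (K : ℝ) (hgK : ∀ᵐ ω ∂P, g (J ω) ≤ K) :
    Measurable (fun ω => G (J ω) ω) ∧
    ∫ ω, g (J ω) * G (J ω) ω ∂P ≤ (∫ ω, g (J ω) ∂P) * (A + c * M) := by
  have hW : Measurable (fun ω => G (J ω) ω) := by
    have : Measurable (fun p : Ω × ℕ => G p.2 p.1) := measurable_from_prod_countable_left hG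
    exact this.comp (measurable_id.prodMk hJ)
  refine ⟨hW, ?_⟩
  have hgm : Measurable (fun ω => g (J ω)) := (measurable_of_countable g).comp hJ
  have hA0 : 0 ≤ A := by rw [← hA 0]; exact integral_nonneg (hG0 0)
  have hAc : 0 ≤ A + c * M := by positivity
  have hAl : ∀ j, ∫⁻ ω, ENNReal.ofReal (G j ω) ∂P = ENNReal.ofReal A := by
    intro j
    rw [← hA j, ofReal_integral_eq_lintegral_ofReal _ (Eventually.of_forall (hG0 j))]
    refine Integrable.of_bound (hG j).aestronglyMeasurable M ?_
    filter_upwards [hGM j] with ω hω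
    rw [Real.norm_of_nonneg (hG0 j ω)]; exact hω
  have hgi : Integrable (fun ω => g (J ω)) P := by
    refine Integrable.of_bound hgm.aestronglyMeasurable K ?_
    filter_upwards [hgK] with ω hω
    rw [Real.norm_of_nonneg (hg _)]; exact hω
  have hdec : ∀ f : Ω → ENNReal, ∫⁻ ω, f ω ∂P = ∑' j, ∫⁻ ω in J ⁻¹' {j}, f ω ∂P := by
    intro f
    rw [← lintegral_iUnion (fun j => hJ (measurableSet_singleton j))]
    · rw [← Set.preimage_iUnion, Set.iUnion_of_singleton, Set.preimage_univ, Measure.restrict_univ]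
    · intro i j hij
      refine Disjoint.preimage J ?_
      simpa using hij
  rw [integral_eq_lintegral_of_nonneg_ae (Eventually.of_forall fun ω => mul_nonneg (hg _) (hG0 _ _))
    (hgm.mul hW).aestronglyMeasurable]
  apply ENNReal.toReal_le_of_le_ofReal (mul_nonneg (integral_nonneg fun ω => hg _) hAc)
  rw [ENNReal.ofReal_mul (integral_nonneg fun ω => hg _), 
    ofReal_integral_eq_lintegral_ofReal hgi (Eventually.of_forall fun ω => hg _), hdec, hdec (fun ω => ENNReal.ofReal (g (J ω))), ← ENNReal.tsum_mul_right]
  apply ENNReal.tsum_le_tsum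
  intro j
  have hm : MeasurableSet (J ⁻¹' {j}) := hJ (measurableSet_singleton j)
  have e1 : ∫⁻ ω in J ⁻¹' {j}, ENNReal.ofReal (g (J ω) * G (J ω) ω) ∂P
      = ENNReal.ofReal (g j) * ∫⁻ ω in J ⁻¹' {j}, ENNReal.ofReal (G j ω) ∂P := by
    rw [← lintegral_const_mul _ (hG j).ennreal_ofReal]
    apply setLIntegral_congr_fun hm
    intro ω hω
    have : J ω = j := hω
    simp only [this]
    rw [ENNReal.ofReal_mul (hg j)]
  have e2 : ∫⁻ ω in J ⁻¹' {j}, ENNReal.ofReal (g (J ω)) ∂P = ENNReal.ofReal (g j) * P (J ⁻¹' {j}) := by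
    rw [← setLIntegral_const]
    apply setLIntegral_congr_fun hm
    intro ω hω
    have : J ω = j := hω
    simp only [this]
  rw [e1, e2, mul_assoc]
  gcongr
  refine (H j).trans ?_
  rw [hAl, ENNReal.ofReal_add hA0 (mul_nonneg hc hM), ENNReal.ofReal_mul hc]

theorem aux_doubling {Ω : Type*} [m0 : MeasurableSpace Ω] (P : Measure Ω) [IsProbabilityMeasure P]
    (Z : ℕ → Ω → ℝ) (hZ : ∀ k, Measurable (Z k)) (D : ℝ) (hb : ∀ k, ∀ᵐ ω ∂P, |Z k ω| ≤ D)
    (e : ℕ → ℝ) (he : Summable e) (he0 : ∀ k, 0 ≤ e k)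
    (h : ∀ k, ∫ ω, Z (k+1) ω ^ 2 ∂P ≤ (∫ ω, Z k ω ^ 2 ∂P) / 2 + (∫ ω, Z k ω ∂P)^2 / 2 + e k)
    (L : ℝ) (hL : Tendsto (fun k => ∫ ω, Z k ω ∂P) atTop (nhds L)) :
    ∀ᵐ ω ∂P, Tendsto (fun k => Z k ω) atTop (nhds L) := by
  have hi : ∀ k, Integrable (Z k) P := fun k =>
    Integrable.of_bound (hZ k).aestronglyMeasurable D (hb k)
  have hi2 : ∀ k, Integrable (fun ω => Z k ω ^ 2) P := fun k => by
    refine Integrable.of_bound ((hZ k).pow_const 2).aestronglyMeasurable (D^2) ?_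
    filter_upwards [hb k] with ω hω
    rw [norm_pow]
    exact pow_le_pow_left₀ (norm_nonneg _) hω 2
  set b : ℕ → ℝ := fun k => ∫ ω, Z k ω ∂P with hbd
  set V : ℕ → ℝ := fun k => ∫ ω, (Z k ω - b k)^2 ∂P with hV
  have hVi : ∀ k, Integrable (fun ω => (Z k ω - b k)^2) P := by
    intro k
    have : (fun ω => (Z k ω - b k)^2) = fun ω => Z k ω ^ 2 - 2 * b k * Z k ω + b k ^ 2 := by
      ext ω; ring
    rw [this]
    exact ((hi2 k).sub ((hi k).const_mul _)).add (integrable_const _)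
  have hVe : ∀ k, V k = ∫ ω, Z k ω ^ 2 ∂P - b k ^ 2 := by
    intro k
    have : (fun ω => (Z k ω - b k)^2) = fun ω => Z k ω ^ 2 - 2 * b k * Z k ω + b k ^ 2 := by
      ext ω; ring
    rw [hV]; simp only
    rw [this, integral_add (f := fun ω => Z k ω ^ 2 - 2 * b k * Z k ω) (((hi2 k).sub ((hi k).const_mul _))) (integrable_const _),
      integral_sub (hi2 k) ((hi k).const_mul _), integral_const_mul]
    simp only [integral_const, probReal_univ, smul_eq_mul]
    change _ - 2 * b k * b k + _ = _
    ring
  have hVs : Summable V := by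
    refine aux_summable V (fun k => b k ^ 2) e (fun k => integral_nonneg fun ω => sq_nonneg _) (fun k => sq_nonneg _) he he0 ?_
    intro k
    have := h k
    rw [hVe, hVe]
    change _ ≤ _ + b k ^2 / 2 + _ at this
    linarith
  have hm : ∀ k, Measurable fun ω => ENNReal.ofReal ((Z k ω - b k)^2) := fun k =>
    (((hZ k).sub_const _).pow_const 2).ennreal_ofReal
  have hfin : ∫⁻ ω, ∑' k, ENNReal.ofReal ((Z k ω - b k)^2) ∂P ≠ ⊤ := by
    rw [lintegral_tsum fun k => (hm k).aemeasurable]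
    have : ∀ k, ∫⁻ ω, ENNReal.ofReal ((Z k ω - b k)^2) ∂P = ENNReal.ofReal (V k) := fun k => by
      rw [hV, ofReal_integral_eq_lintegral_ofReal (hVi k) (Eventually.of_forall fun ω => sq_nonneg _)]
    simp_rw [this]
    exact hVs.tsum_ofReal_ne_top
  filter_upwards [ae_lt_top (Measurable.tsum hm) hfin] with ω hω
  have h1 : Tendsto (fun k => ENNReal.ofReal ((Z k ω - b k)^2)) atTop (nhds 0) :=
    ENNReal.tendsto_atTop_zero_of_tsum_ne_top hω.ne
  have h2 : Tendsto (fun k => (Z k ω - b k)^2) atTop (nhds 0) := by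
    have := (ENNReal.tendsto_toReal ENNReal.zero_ne_top).comp h1
    simpa [Function.comp_def, ENNReal.toReal_ofReal, sq_nonneg] using this
  have h3 : Tendsto (fun k => Z k ω - b k) atTop (nhds 0) := by
    rw [tendsto_zero_iff_abs_tendsto_zero]
    have := (Real.continuous_sqrt.tendsto 0).comp h2
    simpa [Function.comp_def, Real.sqrt_sq_eq_abs] using this
  simpa using h3.add hL

theorem aux_shift {Ω : Type*} (X : ℝ → ℕ → ℕ → Ω → ℝ) (C : ℝ) (hC : 0 ≤ C) (c : ℝ) (hc : 0 < c)
    (h6 : ∀ t : ℝ, 0 ≤ t → ∀ s ∈ Set.Icc C (C + c), ∀ m n : ℕ, m < n → ∀ ω,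
      X t m n ω ≤ X (t + s) m n ω + s) :
    ∀ t : ℝ, 0 ≤ t → ∀ s, C * (C + c) / c ≤ s → ∀ m n : ℕ, m < n → ∀ ω,
      X t m n ω ≤ X (t + s) m n ω + s := by
  have key : ∀ k : ℕ, ∀ r ∈ Set.Icc C (C + c), ∀ t : ℝ, 0 ≤ t → ∀ m n : ℕ, m < n → ∀ ω,
      X t m n ω ≤ X (t + k * r) m n ω + k * r := by
    intro k r hr
    induction k with
    | zero => intro t ht m n hmn ω; simp
    | succ k ih =>
      intro t ht m n hmn ω
      have h1 := ih t ht m n hmn ω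
      have hr0 : 0 ≤ r := le_trans hC hr.1
      have h2 := h6 (t + k * r) (by positivity) r hr m n hmn ω
      have e : t + ((k+1 : ℕ):ℝ) * r = t + k * r + r := by push_cast; ring
      rw [e]; push_cast; linarith
  intro t ht s hs m n hmn ω
  have hCc : 0 < C + c := by linarith
  have hs0 : 0 ≤ s := le_trans (by positivity) hs
  rcases hs0.eq_or_lt with h0 | hpos
  · rw [← h0]; simp
  · set k := ⌈s / (C + c)⌉₊ with hk
    have hk1 : s / (C + c) ≤ k := Nat.le_ceil _
    have hk2 : (k:ℝ) < s / (C + c) + 1 := Nat.ceil_lt_add_one (by positivity)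
    have hkpos : (0:ℝ) < k := lt_of_lt_of_le (by positivity) hk1
    have h1 : C ≤ s / k := by
      rw [le_div_iff₀ hkpos]
      have : C * k ≤ C * (s / (C + c) + 1) := by gcongr
      refine this.trans ?_
      rw [div_le_iff₀ hc] at hs
      rw [← mul_le_mul_iff_left₀ hCc]
      have : C * (s / (C + c) + 1) * (C + c) = C * s + C * (C + c) := by field_simp
      rw [this]; linarith
    have h2 : s / k ≤ C + c := by
      rw [div_le_iff₀ hkpos]
      rw [div_le_iff₀ hCc] at hk1
      linarith
    have := key k (s/k) ⟨h1, h2⟩ t ht m n hmn ω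
    have e : (k:ℝ) * (s/k) = s := by field_simp
    rwa [e] at this

theorem aux_core {Ω : Type*} [m0 : MeasurableSpace Ω] (P : Measure Ω) [IsProbabilityMeasure P]
    (Fm Fp : ℝ → MeasurableSpace Ω)
    (hFm_le : ∀ t : ℝ, 0 ≤ t → Fm t ≤ m0) (hFp_le : ∀ t : ℝ, 0 ≤ t → Fp t ≤ m0)
    (hFm_mono : ∀ s t : ℝ, 0 ≤ s → s ≤ t → Fm s ≤ Fm t)
    (X : ℝ → ℕ → ℕ → Ω → ℝ)
    (hX_nonneg : ∀ t : ℝ, 0 ≤ t → ∀ m n : ℕ, ∀ ω, 0 ≤ X t m n ω)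
    (h1 : ∀ t : ℝ, 0 ≤ t → ∀ m k n : ℕ, m < k → k < n → ∀ ω,
      X t m n ω ≤ X t m k ω + X (t + X t m k ω) k n ω)
    (h4a : ∀ t : ℝ, 0 ≤ t → ∀ m n : ℕ, m < n → Measurable[Fp t] (X t m n))
    (h4b : ∀ t : ℝ, 0 ≤ t → ∀ m n : ℕ, m < n → ∀ s : ℝ, 0 ≤ s →
      MeasurableSet[Fm (t + s)] {ω | X t m n ω ≤ s})
    (hid : ∀ t : ℝ, 0 ≤ t → ∀ m n : ℕ, 1 ≤ n →
      Measure.map (X t m (m+n)) P = Measure.map (X 0 0 n) P)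
    (S D : ℝ) (hS : 0 ≤ S) (hD : 0 ≤ D)
    (h6 : ∀ t : ℝ, 0 ≤ t → ∀ s, S ≤ s → ∀ m n : ℕ, m < n → ∀ ω,
      X t m n ω ≤ X (t + s) m n ω + s)
    (hbd : ∀ᵐ ω ∂P, ∀ t : ℝ, 0 ≤ t → ∀ m n : ℕ, 1 ≤ n → X t m (m+n) ω ≤ D * n)
    (φ : ℝ → ℝ) (hφ0 : ∀ s, 0 ≤ φ s)
    (hmix : ∀ s t, 0 ≤ t → ∀ Ev Fv : Set Ω, MeasurableSet[Fm t] Ev → MeasurableSet[Fp (t + s)] Fv →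
      P (Fv ∩ Ev) ≤ P Ev * (P Fv + ENNReal.ofReal (φ s)))
    (s : ℝ) (hs : S ≤ s) (m n : ℕ) (hm : 1 ≤ m) (hn : 1 ≤ n) :
    (∫ ω, X 0 0 (m+n) ω ∂P) ≤ ∫ ω, X 0 0 m ω ∂P + ∫ ω, X 0 0 n ω ∂P + (s + 2) + φ s * (D * n) ∧
    (∫ ω, X 0 0 (m+n) ω ^ 2 ∂P) ≤ (∫ ω, X 0 0 m ω ^ 2 ∂P + 2 * (s+2) * ∫ ω, X 0 0 m ω ∂P + (s+2)^2)
      + 2 * ((∫ ω, X 0 0 m ω ∂P + (s+2)) * (∫ ω, X 0 0 n ω ∂P + φ s * (D * n)))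
      + (∫ ω, X 0 0 n ω ^ 2 ∂P + φ s * (D * n)^2) := by
  have hs0 : 0 ≤ s := hS.trans hs
  have hmeas : ∀ t : ℝ, 0 ≤ t → ∀ m n : ℕ, m < n → Measurable (X t m n) := fun t ht m n hmn =>
    (h4a t ht m n hmn).mono (hFp_le t ht) le_rfl
  have hint : ∀ n, 1 ≤ n → Integrable (X 0 0 n) P := fun n hn => by
    refine Integrable.of_bound (hmeas 0 le_rfl 0 n hn).aestronglyMeasurable (D * n) ?_
    filter_upwards [hbd] with ω hω
    rw [Real.norm_of_nonneg (hX_nonneg _ le_rfl _ _ _)]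
    simpa using hω 0 le_rfl 0 n hn
  have hint2 : ∀ n, 1 ≤ n → Integrable (fun ω => X 0 0 n ω ^ 2) P := fun n hn => by
    refine Integrable.of_bound ((hmeas 0 le_rfl 0 n hn).pow_const 2).aestronglyMeasurable ((D * n)^2) ?_
    filter_upwards [hbd] with ω hω
    rw [norm_pow, Real.norm_of_nonneg (hX_nonneg _ le_rfl _ _ _)]
    have := hω 0 le_rfl 0 n hn
    rw [zero_add] at this
    exact pow_le_pow_left₀ (hX_nonneg _ le_rfl _ _ _) this 2
  set τ : Ω → ℝ := X 0 0 m with hτ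
  have hτ0 : ∀ ω, 0 ≤ τ ω := fun ω => hX_nonneg _ le_rfl _ _ _
  set J : Ω → ℕ := fun ω => ⌈τ ω⌉₊ with hJd
  have hJ : Measurable J := (hmeas 0 le_rfl 0 m hm).nat_ceil
  have hJE : ∀ j : ℕ, MeasurableSet[Fm (j:ℝ)] (J ⁻¹' {j}) := by
    have hle : ∀ j : ℕ, MeasurableSet[Fm (j:ℝ)] {ω | τ ω ≤ j} := fun j => by
      have := h4b 0 le_rfl 0 m hm j (Nat.cast_nonneg j)
      rwa [zero_add] at this
    intro j
    rcases j with _ | j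
    · have : J ⁻¹' {0} = {ω | τ ω ≤ ((0:ℕ):ℝ)} := by
        ext ω; simp [hJd]
      rw [this]; exact hle 0
    · have : J ⁻¹' {j+1} = {ω | τ ω ≤ ((j+1:ℕ):ℝ)} \ {ω | τ ω ≤ (j:ℝ)} := by
        ext ω
        simp only [Set.mem_preimage, Set.mem_singleton_iff, Set.mem_sdiff, Set.mem_ofPred_eq, hJd]
        rw [← Nat.ceil_le, ← Nat.ceil_le]
        omega
      rw [this]
      refine MeasurableSet.diff (hle (j+1)) ?_
      exact hFm_mono (j:ℝ) ((j+1:ℕ):ℝ) (Nat.cast_nonneg j) (by push_cast; linarith) _ (hle j)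
  set Y : ℕ → Ω → ℝ := fun j => X (j + s) m (m+n) with hY
  have hjs : ∀ j : ℕ, (0:ℝ) ≤ j + s := fun j => by positivity
  have hYp : ∀ j : ℕ, Measurable[Fp (j+s)] (Y j) := fun j => h4a _ (hjs j) _ _ (by omega)
  have hYm : ∀ j, Measurable (Y j) := fun j => hmeas _ (hjs j) _ _ (by omega)
  have hY0 : ∀ j ω, 0 ≤ Y j ω := fun j ω => hX_nonneg _ (hjs j) _ _ _
  have hYM : ∀ j, ∀ᵐ ω ∂P, Y j ω ≤ D * n := fun j => by
    filter_upwards [hbd] with ω hω using hω _ (hjs j) m n hn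
  have hYint : ∀ (f : ℝ → ℝ), Measurable f → ∀ j, ∫ ω, f (Y j ω) ∂P = ∫ ω, f (X 0 0 n ω) ∂P := by
    intro f hf j
    rw [← integral_map (φ := Y j) (hYm j).aemeasurable hf.aestronglyMeasurable,
      ← integral_map (φ := X 0 0 n) (hmeas 0 le_rfl 0 n hn).aemeasurable hf.aestronglyMeasurable,
      hY, hid _ (hjs j) m n hn]
  have hDn : 0 ≤ D * n := by positivity
  have hJbd : ∀ᵐ ω ∂P, (J ω : ℝ) ≤ τ ω + 1 := Eventually.of_forall fun ω =>
    (Nat.ceil_lt_add_one (hτ0 ω)).le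
  have hτbd : ∀ᵐ ω ∂P, τ ω ≤ D * m := by
    filter_upwards [hbd] with ω hω
    simpa using hω 0 le_rfl 0 m hm
  have gen := fun (G : ℕ → Ω → ℝ) (hG : ∀ j : ℕ, Measurable[Fp (j+s)] (G j)) (hG0 : ∀ j ω, 0 ≤ G j ω)
      (A M : ℝ) (hM : 0 ≤ M) (hGM : ∀ j, ∀ᵐ ω ∂P, G j ω ≤ M) (hA : ∀ j, ∫ ω, G j ω ∂P = A) =>
    aux_sum P J hJ G (fun j => (hG j).mono (hFp_le _ (hjs j)) le_rfl) hG0 A M (φ s) (hφ0 s) hM hGM hA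
      (fun j => aux_layer (Fp (j+s)) P (hFp_le _ (hjs j)) (J ⁻¹' {j}) (hJ (measurableSet_singleton j))
        (ENNReal.ofReal (φ s)) (fun F hF => hmix s j (Nat.cast_nonneg j) _ F (hJE j) hF)
        (G j) (hG j) (hG0 j) M (hGM j))
  set W : Ω → ℝ := fun ω => Y (J ω) ω with hWd
  set a := ∫ ω, X 0 0 n ω ∂P with ha
  set q := ∫ ω, X 0 0 n ω ^ 2 ∂P with hq
  have genY := gen Y hYp hY0 a (D*n) hDn hYM (hYint id measurable_id)
  have genY2 := gen (fun j ω => Y j ω ^ 2) (fun j => (hYp j).pow_const 2) (fun j ω => sq_nonneg _) q ((D*n)^2)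
    (sq_nonneg _) (fun j => by
      filter_upwards [hYM j] with ω hω
      exact pow_le_pow_left₀ (hY0 j ω) hω 2) (hYint (fun x => x^2) (measurable_id.pow_const 2))
  have hW : Measurable W := (genY (fun _ => 1) (fun _ => zero_le_one) 1 (by simp)).1
  have W1 : ∫ ω, W ω ∂P ≤ a + φ s * (D*n) := by
    have := (genY (fun _ => 1) (fun _ => zero_le_one) 1 (by simp)).2
    simpa using this
  have W2 : ∫ ω, W ω ^ 2 ∂P ≤ q + φ s * (D*n)^2 := by
    have := (genY2 (fun _ => 1) (fun _ => zero_le_one) 1 (by simp)).2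
    simpa using this
  set J' : Ω → ℝ := fun ω => J ω + (s + 1) with hJ'
  have hJ'0 : ∀ ω, 0 ≤ J' ω := fun ω => by rw [hJ']; positivity
  have hJ'm : Measurable J' := ((measurable_of_countable (fun j : ℕ => (j:ℝ))).comp hJ).add_const _
  have hJ'τ : ∀ ω, J' ω ≤ τ ω + (s+2) := fun ω => by
    have : (J ω : ℝ) < τ ω + 1 := Nat.ceil_lt_add_one (hτ0 ω)
    simp only [hJ']; linarith
  have hJ'K : ∀ᵐ ω ∂P, J' ω ≤ D * m + (s+2) := by
    filter_upwards [hτbd] with ω hω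
    have := hJ'τ ω
    linarith
  have W3 : ∫ ω, J' ω * W ω ∂P ≤ (∫ ω, J' ω ∂P) * (a + φ s * (D*n)) :=
    (genY (fun j => j + (s+1)) (fun j => by positivity) (D * m + (s+2)) hJ'K).2
  have hWM : ∀ᵐ ω ∂P, W ω ≤ D * n := by
    filter_upwards [hbd] with ω hω using hω _ (hjs _) m n hn
  have hW0 : ∀ ω, 0 ≤ W ω := fun ω => hY0 _ _
  have iJ : Integrable J' P := by
    refine Integrable.of_bound hJ'm.aestronglyMeasurable (D * m + (s+2)) ?_
    filter_upwards [hJ'K] with ω hω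
    rwa [Real.norm_of_nonneg (hJ'0 ω)]
  have iW : Integrable W P := by
    refine Integrable.of_bound hW.aestronglyMeasurable (D * n) ?_
    filter_upwards [hWM] with ω hω
    rwa [Real.norm_of_nonneg (hW0 ω)]
  have iJ2 : Integrable (fun ω => J' ω ^ 2) P := by
    refine Integrable.of_bound (hJ'm.pow_const 2).aestronglyMeasurable ((D * m + (s+2))^2) ?_
    filter_upwards [hJ'K] with ω hω
    rw [norm_pow, Real.norm_of_nonneg (hJ'0 ω)]
    exact pow_le_pow_left₀ (hJ'0 ω) hω 2
  have iW2 : Integrable (fun ω => W ω ^ 2) P := by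
    refine Integrable.of_bound (hW.pow_const 2).aestronglyMeasurable ((D * n)^2) ?_
    filter_upwards [hWM] with ω hω
    rw [norm_pow, Real.norm_of_nonneg (hW0 ω)]
    exact pow_le_pow_left₀ (hW0 ω) hω 2
  have iJW : Integrable (fun ω => J' ω * W ω) P := by
    refine Integrable.of_bound (hJ'm.mul hW).aestronglyMeasurable ((D * m + (s+2)) * (D * n)) ?_
    filter_upwards [hWM, hJ'K] with ω hω hω'
    rw [Real.norm_of_nonneg (mul_nonneg (hJ'0 ω) (hW0 ω))]
    exact mul_le_mul hω' hω (hW0 ω) (by positivity)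
  have hmain : ∀ ω, X 0 0 (m+n) ω ≤ J' ω + W ω := by
    intro ω
    have e1 := h1 0 le_rfl 0 m (m+n) (by omega) (by omega) ω
    have hle : τ ω ≤ J ω := Nat.le_ceil _
    have hlt : (J ω : ℝ) < τ ω + 1 := Nat.ceil_lt_add_one (hτ0 ω)
    have e2 := h6 (0 + X 0 0 m ω) (by simpa using hτ0 ω) (J ω - τ ω + s) (by linarith) m (m+n) (by omega) ω
    have e3 : 0 + X 0 0 m ω + (J ω - τ ω + s) = J ω + s := by rw [hτ]; ring
    rw [e3] at e2
    change _ ≤ W ω + _ at e2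
    change _ ≤ τ ω + _ at e1
    simp only [hJ']
    linarith
  have J1 : ∫ ω, J' ω ∂P ≤ ∫ ω, τ ω ∂P + (s+2) := by
    have : ∫ ω, (τ ω + (s+2)) ∂P = ∫ ω, τ ω ∂P + (s+2) := by
      rw [integral_add (hint m hm) (integrable_const _)]; simp; rfl
    rw [← this]
    exact integral_mono iJ ((hint m hm).add (integrable_const _)) hJ'τ
  have J2 : ∫ ω, J' ω ^ 2 ∂P ≤ ∫ ω, τ ω ^ 2 ∂P + 2 * (s+2) * ∫ ω, τ ω ∂P + (s+2)^2 := by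
    have hi : Integrable (fun ω => τ ω ^ 2 + 2 * (s+2) * τ ω) P := (hint2 m hm).add ((hint m hm).const_mul _)
    have : ∫ ω, (τ ω ^ 2 + 2 * (s+2) * τ ω + (s+2)^2) ∂P = ∫ ω, τ ω ^ 2 ∂P + 2 * (s+2) * ∫ ω, τ ω ∂P + (s+2)^2 := by
      rw [integral_add hi (integrable_const _), integral_add (hint2 m hm) ((hint m hm).const_mul _), integral_const_mul]
      simp; rfl
    rw [← this]
    refine integral_mono iJ2 (hi.add (integrable_const _)) ?_
    intro ω
    have := pow_le_pow_left₀ (hJ'0 ω) (hJ'τ ω) 2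
    simp only
    linarith
  have ha0 : 0 ≤ a + φ s * (D*n) := by
    have : 0 ≤ a := integral_nonneg fun ω => hX_nonneg _ le_rfl _ _ _
    have := hφ0 s
    positivity
  constructor
  · calc ∫ ω, X 0 0 (m+n) ω ∂P ≤ ∫ ω, (J' ω + W ω) ∂P :=
          integral_mono (hint _ (by omega)) (iJ.add iW) hmain
      _ = ∫ ω, J' ω ∂P + ∫ ω, W ω ∂P := integral_add iJ iW
      _ ≤ _ := by linarith
  · have W3' : (∫ ω, J' ω ∂P) * (a + φ s * (D*n)) ≤ (∫ ω, τ ω ∂P + (s+2)) * (a + φ s * (D*n)) := by gcongr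
    have iJJ : Integrable (fun ω => J' ω ^ 2 + 2 * (J' ω * W ω)) P := iJ2.add (iJW.const_mul 2)
    calc ∫ ω, X 0 0 (m+n) ω ^ 2 ∂P ≤ ∫ ω, (J' ω ^ 2 + 2 * (J' ω * W ω) + W ω ^ 2) ∂P := by
          refine integral_mono (hint2 _ (by omega)) (iJJ.add iW2) ?_
          intro ω
          have := pow_le_pow_left₀ (hX_nonneg _ le_rfl _ _ _) (hmain ω) 2
          simp only
          linarith
      _ = ∫ ω, J' ω ^ 2 ∂P + 2 * ∫ ω, J' ω * W ω ∂P + ∫ ω, W ω ^ 2 ∂P := by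
          rw [integral_add iJJ iW2, integral_add iJ2 (iJW.const_mul 2), integral_const_mul]
      _ ≤ _ := by linarith

/-- **Non-autonomous subadditive theorem (almost-sure version).**
Under hypotheses (1)-(4) and (6) on the family `X_{m,n}^t`, and polynomial decay of the mixing
coefficient `φ`, the limit `L = lim E[X_{0,n}^0]/n` exists and `X_{0,n}^0/n → L` almost surely. -/
theorem nonautonomous_subadditive_almost_sure
    {Ω : Type*} [m0 : MeasurableSpace Ω] (P : Measure Ω) [IsProbabilityMeasure P]
    (Fm Fp : ℝ → MeasurableSpace Ω)
    (hFm_le : ∀ t : ℝ, 0 ≤ t → Fm t ≤ m0) (hFp_le : ∀ t : ℝ, 0 ≤ t → Fp t ≤ m0)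
    (hFm_mono : ∀ s t : ℝ, 0 ≤ s → s ≤ t → Fm s ≤ Fm t)
    (hFp_anti : ∀ s t : ℝ, 0 ≤ s → s ≤ t → Fp t ≤ Fp s)
    (X : ℝ → ℕ → ℕ → Ω → ℝ)
    (hX_nonneg : ∀ t : ℝ, 0 ≤ t → ∀ m n : ℕ, ∀ ω, 0 ≤ X t m n ω)
    (C : ℝ) (hC : 0 ≤ C)
    -- (1) subadditivity along time shifts
    (h1 : ∀ t : ℝ, 0 ≤ t → ∀ m k n : ℕ, m < k → k < n → ∀ ω,
      X t m n ω ≤ X t m k ω + X (t + X t m k ω) k n ω)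
    -- (2) boundedness of the basic block
    (h2 : ∀ ω, X 0 0 1 ω ≤ C)
    -- (3) the joint distribution of (X_{m,m+1}^t, X_{m,m+2}^t, ...) is independent of (t,m)
    (h3 : ∀ t : ℝ, 0 ≤ t → ∀ m : ℕ,
      Measure.map (fun ω => fun j : ℕ => X t m (m + 1 + j) ω) P
        = Measure.map (fun ω => fun j : ℕ => X 0 0 (1 + j) ω) P)
    -- (4) measurability with respect to the filtrations
    (h4a : ∀ t : ℝ, 0 ≤ t → ∀ m n : ℕ, m < n → Measurable[Fp t] (X t m n))
    (h4b : ∀ t : ℝ, 0 ≤ t → ∀ m n : ℕ, m < n → ∀ s : ℝ, 0 ≤ s →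
      MeasurableSet[Fm (t + s)] {ω | X t m n ω ≤ s})
    -- (6) approximate monotonicity in the starting time
    (h6 : ∃ c : ℝ, 0 < c ∧ ∀ t : ℝ, 0 ≤ t → ∀ s ∈ Set.Icc C (C + c), ∀ m n : ℕ, m < n → ∀ ω,
      X t m n ω ≤ X (t + s) m n ω + s)
    -- (5) the mixing coefficient and its polynomial decay
    (φ : ℝ → ℝ)
    (hφ : ∀ s : ℝ, φ s = sSup {r | ∃ t : ℝ, 0 ≤ t ∧ ∃ Ev Fv : Set Ω,
      MeasurableSet[Fm t] Ev ∧ MeasurableSet[Fp (t + s)] Fv ∧ 0 < P Ev ∧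
      r = |(P (Fv ∩ Ev)).toReal / (P Ev).toReal - (P Fv).toReal|})
    (α : ℝ) (hα : 0 < α)
    (h5 : Tendsto (fun s : ℝ => s ^ α * φ s) atTop (nhds 0)) :
    ∃ L : ℝ,
      Tendsto (fun n : ℕ => (∫ ω, X 0 0 n ω ∂P) / n) atTop (nhds L) ∧
      ∀ᵐ ω ∂P, Tendsto (fun n : ℕ => X 0 0 n ω / n) atTop (nhds L) := by
  obtain ⟨c, hc, h6⟩ := h6
  have h6' := aux_shift X C hC c hc h6
  set S := C * (C + c) / c with hSd
  have hS : 0 ≤ S := by have : 0 ≤ C + c := by linarith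
                        positivity
  obtain ⟨hφ0, hφ1, hmix⟩ := aux_mix P Fm Fp φ hφ
  have hmeas : ∀ t : ℝ, 0 ≤ t → ∀ m n : ℕ, m < n → Measurable (X t m n) := fun t ht m n hmn =>
    (h4a t ht m n hmn).mono (hFp_le t ht) le_rfl
  have hid : ∀ t : ℝ, 0 ≤ t → ∀ m n : ℕ, 1 ≤ n →
      Measure.map (X t m (m+n)) P = Measure.map (X 0 0 n) P := by
    intro t ht m n hn
    obtain ⟨k, rfl⟩ := Nat.exists_eq_add_of_le hn
    have hm1 : Measurable (fun ω => fun j : ℕ => X t m (m + 1 + j) ω) :=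
      measurable_pi_lambda _ fun j => hmeas t ht _ _ (by omega)
    have hm2 : Measurable (fun ω => fun j : ℕ => X 0 0 (1 + j) ω) :=
      measurable_pi_lambda _ fun j => hmeas 0 le_rfl _ _ (by omega)
    have := congrArg (Measure.map (fun f : ℕ → ℝ => f k)) (h3 t ht m)
    rw [Measure.map_map (measurable_pi_apply k) hm1, Measure.map_map (measurable_pi_apply k) hm2] at this
    simpa [Function.comp_def, add_assoc] using this
  have hone : ∀ᵐ ω ∂P, ∀ j m : ℕ, X j m (m+1) ω ≤ C := by
    rw [ae_all_iff]; intro j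
    rw [ae_all_iff]; intro m
    have e1 : ∀ᵐ y ∂(Measure.map (X 0 0 1) P), y ≤ C := by
      rw [ae_map_iff (hmeas 0 le_rfl 0 1 one_pos).aemeasurable measurableSet_Iic]
      exact Eventually.of_forall h2
    rw [← hid j (Nat.cast_nonneg j) m 1 le_rfl] at e1
    exact (ae_map_iff (hmeas j (Nat.cast_nonneg j) m (m+1) (by omega)).aemeasurable measurableSet_Iic).mp e1
  set D := C + S + 1 with hDd
  have hD : 0 ≤ D := by positivity
  have hbd : ∀ᵐ ω ∂P, ∀ t : ℝ, 0 ≤ t → ∀ m n : ℕ, 1 ≤ n → X t m (m+n) ω ≤ D * n := by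
    filter_upwards [hone] with ω hω
    have hstep : ∀ t : ℝ, 0 ≤ t → ∀ m, X t m (m+1) ω ≤ D := by
      intro t ht m
      have a1 : t + S ≤ ⌈t + S⌉₊ := Nat.le_ceil _
      have a2 : (⌈t + S⌉₊ : ℝ) < t + S + 1 := Nat.ceil_lt_add_one (by positivity)
      have a3 := h6' t ht (⌈t + S⌉₊ - t) (by linarith) m (m+1) (by omega) ω
      have e : t + ((⌈t + S⌉₊ : ℝ) - t) = ⌈t + S⌉₊ := by ring
      rw [e] at a3
      have := hω ⌈t + S⌉₊ m
      linarith
    intro t ht m n hn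
    induction n, hn using Nat.le_induction with
    | base => simpa using hstep t ht m
    | succ n hn ih =>
      have b1 := h1 t ht m (m+n) (m+(n+1)) (by omega) (by omega) ω
      have b2 := hstep (t + X t m (m+n) ω) (add_nonneg ht (hX_nonneg t ht _ _ _)) (m+n)
      rw [← add_assoc] at b1 ⊢
      push_cast
      linarith
  have core := aux_core P Fm Fp hFm_le hFp_le hFm_mono X hX_nonneg h1 h4a h4b hid S D hS hD h6' hbd φ hφ0 hmix
  set a : ℕ → ℝ := fun n => ∫ ω, X 0 0 n ω ∂P with had
  have ha0 : ∀ n, 0 ≤ a n := fun n => integral_nonneg fun ω => hX_nonneg _ le_rfl _ _ _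
  have hbd0 : ∀ n, 1 ≤ n → ∀ᵐ ω ∂P, X 0 0 n ω ≤ D * n := fun n hn => by
    filter_upwards [hbd] with ω hω
    simpa using hω 0 le_rfl 0 n hn
  have haD : ∀ n, 1 ≤ n → a n ≤ D * n := fun n hn => by
    have : ∫ ω, X 0 0 n ω ∂P ≤ ∫ ω, D * n ∂P := by
      refine integral_mono_of_nonneg (Eventually.of_forall fun ω => hX_nonneg _ le_rfl _ _ _)
        (integrable_const _) (hbd0 n hn)
    simpa using this
  have hφbd : ∀ᶠ s : ℝ in atTop, φ s ≤ s ^ (-α) := by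
    filter_upwards [h5.eventually_lt_const zero_lt_one, eventually_gt_atTop 0] with s hs hs0
    have hp : 0 < s ^ α := Real.rpow_pos_of_pos hs0 α
    rw [Real.rpow_neg hs0.le, ← one_div, le_div_iff₀ hp]
    linarith
  have hφlim : Tendsto φ atTop (nhds 0) :=
    squeeze_zero' (Eventually.of_forall hφ0) hφbd (tendsto_rpow_neg_atTop hα)
  obtain ⟨L, hL⟩ := aux_limit a (fun s : ℕ => φ s) D hD (fun n _ => ha0 n) haD ⌈S⌉₊
    (hφlim.comp tendsto_natCast_atTop_atTop)
    (fun s hs m n hm hn => (core s (Nat.ceil_le.mp hs) m n hm hn).1)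
  refine ⟨L, hL, ?_⟩
  have hdbl : ∀ᵐ ω ∂P, ∀ q : ℕ, 1 ≤ q →
      Tendsto (fun k : ℕ => X 0 0 (q*2^k) ω / ((q*2^k : ℕ):ℝ)) atTop (nhds L) := by
    rw [ae_all_iff]; intro q
    by_cases hq : 1 ≤ q
    swap
    · exact Eventually.of_forall fun ω h => absurd h hq
    suffices h : ∀ᵐ ω ∂P, Tendsto (fun k : ℕ => X 0 0 (q*2^k) ω / ((q*2^k : ℕ):ℝ)) atTop (nhds L) by
      filter_upwards [h] with ω hω _ using hω
    have hN1 : ∀ k, 1 ≤ q * 2^k := fun k => Nat.mul_pos hq (by positivity)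
    have hNp : ∀ k, (0:ℝ) < ((q * 2^k : ℕ):ℝ) := fun k => by exact_mod_cast hN1 k
    set σ : ℕ → ℝ := fun k => S + (3/2)^k with hσ
    set r : ℕ → ℝ := fun k => (σ k + 2) / ((q * 2^k : ℕ):ℝ) with hr
    have hr0 : ∀ k, 0 ≤ r k := fun k => by
      simp only [hr, hσ]; positivity
    have hrle : ∀ k, r k ≤ (S+3) * (3/4)^k := by
      intro k
      simp only [hr, hσ]
      rw [div_le_iff₀ (hNp k)]
      have p1 : (1:ℝ) ≤ (3/2)^k := one_le_pow₀ (by norm_num)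
      have p2 : ((3:ℝ)/4)^k * 2^k = (3/2)^k := by rw [← mul_pow]; norm_num
      have p3 : (1:ℝ) ≤ q := by exact_mod_cast hq
      push_cast
      calc S + (3/2)^k + 2 ≤ (S+3) * (3/2)^k := by nlinarith
        _ ≤ (S+3) * (3/2)^k * q := by
            have : 0 ≤ (S+3) * (3/2:ℝ)^k := by positivity
            nlinarith
        _ = (S+3) * (3/4)^k * (q * 2^k) := by rw [← p2]; ring
    have hrs : Summable r := Summable.of_nonneg_of_le hr0 hrle
      ((summable_geometric_of_lt_one (by norm_num) (by norm_num)).mul_left _)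
    have hr2s : Summable (fun k => r k ^ 2) := by
      refine Summable.of_nonneg_of_le (fun k => sq_nonneg _) (f := fun k => (S+3) * r k) ?_ (hrs.mul_left _)
      intro k
      have : r k ≤ S + 3 := (hrle k).trans (by
        have : ((3:ℝ)/4)^k ≤ 1 := pow_le_one₀ (by norm_num) (by norm_num)
        nlinarith)
      rw [sq]
      exact mul_le_mul_of_nonneg_right this (hr0 k)
    have hφs : Summable (fun k => φ (σ k)) := by
      have hθ : Tendsto (fun k : ℕ => ((3:ℝ)/2)^k) atTop atTop := tendsto_pow_atTop_atTop_of_one_lt (by norm_num)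
      have hσt : Tendsto σ atTop atTop := tendsto_atTop_mono (fun k => by simp only [hσ]; linarith) hθ
      have hgeo : Summable (fun k : ℕ => (((3:ℝ)/2) ^ (-α)) ^ k) :=
        summable_geometric_of_lt_one (by positivity) (Real.rpow_lt_one_of_one_lt_of_neg (by norm_num) (by linarith))
      refine Summable.of_norm_bounded_eventually_nat hgeo ?_
      filter_upwards [hσt.eventually hφbd] with k hk
      rw [Real.norm_of_nonneg (hφ0 _)]
      refine hk.trans ?_
      rw [← Real.rpow_natCast, ← Real.rpow_mul (by norm_num), mul_comm, Real.rpow_mul (by norm_num), Real.rpow_natCast]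
      exact Real.rpow_le_rpow_of_nonpos (by positivity) (by simp only [hσ]; linarith) (by linarith)
    refine aux_doubling P (fun k ω => X 0 0 (q*2^k) ω / ((q*2^k : ℕ):ℝ))
      (fun k => (hmeas 0 le_rfl _ _ (hN1 k)).div_const _) D ?_ 
      (fun k => 3/2 * D * r k + (1/4) * r k ^ 2 + (3/4 * D^2) * φ (σ k))
      (((hrs.mul_left _).add (hr2s.mul_left _)).add (hφs.mul_left _)) ?_ ?_ L ?_
    · intro k
      filter_upwards [hbd0 _ (hN1 k)] with ω hω
      rw [abs_of_nonneg (div_nonneg (hX_nonneg _ le_rfl _ _ _) (hNp k).le), div_le_iff₀ (hNp k)]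
      exact hω
    · intro k
      have := hr0 k
      have := hφ0 (σ k)
      positivity
    · intro k
      have hσS : S ≤ σ k := by
        simp only [hσ]; have : (0:ℝ) ≤ (3/2)^k := by positivity
        linarith
      have hc2 := (core (σ k) hσS (q*2^k) (q*2^k) (hN1 k) (hN1 k)).2
      have e : q * 2^k + q * 2^k = q * 2^(k+1) := by ring
      have e' : ((q * 2^(k+1) : ℕ):ℝ) = 2 * ((q*2^k : ℕ):ℝ) := by push_cast; ring
      rw [e] at hc2
      simp only [div_pow, integral_div]
      rw [e']
      have haB := haD _ (hN1 k)
      have haB0 := ha0 (q*2^k)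
      simp only [had] at haB haB0
      have hNk := hNp k
      have hh : σ k + 2 = r k * ((q*2^k : ℕ):ℝ) := by simp only [hr]; field_simp
      rw [hh] at hc2
      have hrk := hr0 k
      have f0 := hφ0 (σ k)
      have f1 := hφ1 (σ k)
      generalize ((q*2^k : ℕ):ℝ) = N at *
      generalize (∫ ω, X 0 0 (q*2^k) ω ∂P) = A at *
      generalize (∫ ω, X 0 0 (q*2^k) ω ^ 2 ∂P) = Q at *
      generalize (∫ ω, X 0 0 (q*2^(k+1)) ω ^ 2 ∂P) = Q' at *
      generalize r k = ρ at *
      generalize φ (σ k) = f at *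
      have hbig : Q' ≤ 2 * Q + 2 * A^2 + 4 * N^2 * (3/2 * D * ρ + 1/4 * ρ^2 + 3/4*D^2*f) := by
        have g1 : ρ * N * A ≤ ρ * N * (D * N) := by gcongr
        have g2 : A * (f * (D * N)) ≤ (D*N) * (f * (D * N)) := by gcongr
        have g3 : ρ * N * (f * (D * N)) ≤ ρ * N * (1 * (D * N)) := by gcongr
        linarith
      rw [div_le_iff₀ (by positivity)]
      have : (Q / N ^ 2 / 2 + (A / N) ^ 2 / 2 + (3 / 2 * D * ρ + 1 / 4 * ρ ^ 2 + 3 / 4 * D ^ 2 * f)) * (2 * N) ^ 2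
        = 2 * Q + 2 * A^2 + 4 * N^2 * (3/2 * D * ρ + 1/4 * ρ^2 + 3/4*D^2*f) := by
        field_simp; ring
      first
        | (rw [this]; exact hbig)
        | (rw [div_pow] at this; rw [this]; exact hbig)
    · have hsub : Tendsto (fun k : ℕ => q * 2^k) atTop atTop := by
        refine tendsto_atTop_mono (fun k => ?_) (tendsto_pow_atTop_atTop_of_one_lt (one_lt_two (α := ℕ)))
        exact Nat.le_mul_of_pos_left _ hq
      have := hL.comp hsub
      simp only [integral_div]
      exact this
  filter_upwards [hbd, hdbl] with ω hω hd
  refine aux_sandwich (fun n => X 0 0 n ω) D L hD ?_ hd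
  intro n k hn hk
  have b1 := h1 0 le_rfl 0 n (n+k) (by omega) (by omega) ω
  have b2 := hω (0 + X 0 0 n ω) (by simpa using hX_nonneg 0 le_rfl 0 n ω) n k hk
  linarith
end

section
/- (Non-autonomous subadditive theorem, in-probability version.) Assume hypotheses (1)-(4) and (6) on the family X_{m,n}^t, and assume only that lim_{s→∞} φ(s) = 0. Then the limit L := lim_{n→∞} E[X_{0,n}^0]/n exists, X_{0,n}^0/n → L in probability as n → ∞, and moreover liminf_{n→∞} X_{0,n}^0(ω)/n ≥ L for almost every ω ∈ Ω. -/
open MeasureTheory Filter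

structure NSys {Ω : Type*} [m0 : MeasurableSpace Ω] (P : Measure Ω)
    (Fm Fp : ℝ → MeasurableSpace Ω) (X : ℝ → ℕ → ℕ → Ω → ℝ) (K S0 : ℝ) (φ : ℝ → ℝ) : Prop where
  Fm_le : ∀ t : ℝ, 0 ≤ t → Fm t ≤ m0
  Fp_le : ∀ t : ℝ, 0 ≤ t → Fp t ≤ m0
  Fm_mono : ∀ s t : ℝ, 0 ≤ s → s ≤ t → Fm s ≤ Fm t
  nonneg : ∀ t : ℝ, 0 ≤ t → ∀ m n : ℕ, ∀ ω, 0 ≤ X t m n ω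
  sub : ∀ t : ℝ, 0 ≤ t → ∀ m k n : ℕ, m < k → k < n → ∀ ω,
      X t m n ω ≤ X t m k ω + X (t + X t m k ω) k n ω
  law : ∀ t : ℝ, 0 ≤ t → ∀ m : ℕ,
      Measure.map (fun ω => fun j : ℕ => X t m (m + 1 + j) ω) P
        = Measure.map (fun ω => fun j : ℕ => X 0 0 (1 + j) ω) P
  measp : ∀ t : ℝ, 0 ≤ t → ∀ m n : ℕ, m < n → Measurable[Fp t] (X t m n)
  measm : ∀ t : ℝ, 0 ≤ t → ∀ m n : ℕ, m < n → ∀ s : ℝ, 0 ≤ s →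
      MeasurableSet[Fm (t + s)] {ω | X t m n ω ≤ s}
  S0nn : 0 ≤ S0
  Knn : 0 ≤ K
  shift : ∀ t : ℝ, 0 ≤ t → ∀ s, S0 ≤ s → ∀ m n : ℕ, m < n → ∀ ω,
      X t m n ω ≤ X (t + s) m n ω + s
  bdd : ∀ t : ℝ, 0 ≤ t → ∀ m n : ℕ, m < n → ∀ᵐ ω ∂P, X t m n ω ≤ K * ((n : ℝ) - m)
  mix : ∀ s : ℝ, 0 ≤ s → ∀ t : ℝ, 0 ≤ t → ∀ Ev Fv : Set Ω, MeasurableSet[Fm t] Ev →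
      MeasurableSet[Fp (t + s)] Fv →
      |P.real (Fv ∩ Ev) - P.real Fv * P.real Ev| ≤ φ s * P.real Ev
  decay : Tendsto φ atTop (nhds 0)

namespace NSys

theorem mix_of {Ω : Type*} [m0 : MeasurableSpace Ω] (P : Measure Ω) [IsProbabilityMeasure P]
    (Fm Fp : ℝ → MeasurableSpace Ω) (φ : ℝ → ℝ)
    (hφ : ∀ s : ℝ, φ s = sSup {r | ∃ t : ℝ, 0 ≤ t ∧ ∃ Ev Fv : Set Ω,
      MeasurableSet[Fm t] Ev ∧ MeasurableSet[Fp (t + s)] Fv ∧ 0 < P Ev ∧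
      r = |(P (Fv ∩ Ev)).toReal / (P Ev).toReal - (P Fv).toReal|})
    (s : ℝ) (t : ℝ) (ht : 0 ≤ t) (Ev Fv : Set Ω) (hE : MeasurableSet[Fm t] Ev)
    (hF : MeasurableSet[Fp (t + s)] Fv) :
    |P.real (Fv ∩ Ev) - P.real Fv * P.real Ev| ≤ φ s * P.real Ev := by
  rcases eq_or_ne (P Ev) 0 with h0 | h0
  · have h1 : P.real Ev = 0 := by simp [Measure.real, h0]
    have h2 : P.real (Fv ∩ Ev) = 0 := by
      simp [Measure.real, measure_mono_null Set.inter_subset_right h0]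
    simp [h1, h2]
  · have hpos : 0 < P.real Ev := ENNReal.toReal_pos h0 (measure_ne_top _ _)
    have hle : |P.real (Fv ∩ Ev) / P.real Ev - P.real Fv| ≤ φ s := by
      rw [hφ]
      apply le_csSup
      · refine ⟨1, ?_⟩
        rintro r ⟨t', -, E', F', -, -, hp, rfl⟩
        have a1 : (P (F' ∩ E')).toReal ≤ (P E').toReal :=
          ENNReal.toReal_mono (measure_ne_top _ _) (measure_mono Set.inter_subset_right)
        have a2 : 0 < (P E').toReal := ENNReal.toReal_pos hp.ne' (measure_ne_top _ _)
        have a3 : (P (F' ∩ E')).toReal / (P E').toReal ≤ 1 := by rw [div_le_one a2]; exact a1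
        have a4 : 0 ≤ (P (F' ∩ E')).toReal / (P E').toReal := by positivity
        have a5 : (P F').toReal ≤ 1 := measureReal_le_one (μ := P) (s := F')
        have a6 : 0 ≤ (P F').toReal := by positivity
        rw [abs_le]; constructor <;> linarith
      · exact ⟨t, ht, Ev, Fv, hE, hF, pos_iff_ne_zero.2 h0, rfl⟩
    have : P.real (Fv ∩ Ev) - P.real Fv * P.real Ev
        = (P.real (Fv ∩ Ev) / P.real Ev - P.real Fv) * P.real Ev := by field_simp
    rw [this, abs_mul, abs_of_pos hpos]
    gcongr

theorem shift_of {Ω : Type*} (X : ℝ → ℕ → ℕ → Ω → ℝ) (C c : ℝ) (hC : 0 ≤ C) (hc : 0 < c)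
    (h6 : ∀ t : ℝ, 0 ≤ t → ∀ s ∈ Set.Icc C (C + c), ∀ m n : ℕ, m < n → ∀ ω,
      X t m n ω ≤ X (t + s) m n ω + s) (t : ℝ) (ht : 0 ≤ t) (s : ℝ)
    (hs : C * (C + c) / c + c ≤ s) (m n : ℕ) (hmn : m < n) (ω : Ω) :
      X t m n ω ≤ X (t + s) m n ω + s := by
  have key : ∀ u ∈ Set.Icc C (C + c), ∀ j : ℕ, ∀ t : ℝ, 0 ≤ t →
      X t m n ω ≤ X (t + j * u) m n ω + j * u := by
    intro u hu j
    induction j with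
    | zero => intro t ht; simp
    | succ j ih =>
      intro t ht
      have h1 := h6 t ht u hu m n hmn ω
      have h2 := ih (t + u) (by linarith [hu.1])
      have e : t + u + j * u = t + (j + 1 : ℕ) * u := by push_cast; ring
      rw [e] at h2
      push_cast at h2 ⊢
      linarith
  have hCc : 0 < C + c := by linarith
  have hs0 : 0 < s := lt_of_lt_of_le (by positivity) hs
  set j := ⌈s / (C + c)⌉₊ with hj
  have hjpos : 0 < j := Nat.ceil_pos.2 (by positivity)
  have hj1 : s / (C + c) ≤ j := Nat.le_ceil _
  have hj2 : (j : ℝ) < s / (C + c) + 1 := Nat.ceil_lt_add_one (by positivity)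
  have hj0 : (0 : ℝ) < j := by exact_mod_cast hjpos
  have hu : s / j ∈ Set.Icc C (C + c) := by
    constructor
    · rw [le_div_iff₀ hj0]
      have h3 : C * (C + c) ≤ s * c := by
        have : C * (C + c) / c ≤ s := by linarith
        rwa [div_le_iff₀ hc] at this
      have h4 : (s / (C + c) + 1) * C ≤ s := by
        rw [div_add_one hCc.ne', div_mul_eq_mul_div, div_le_iff₀ hCc]; nlinarith
      nlinarith
    · rw [div_le_iff₀ hj0]; rw [div_le_iff₀ hCc] at hj1; linarith
  have := key _ hu j t ht
  rwa [mul_div_cancel₀ _ hj0.ne'] at this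

theorem bdd_of {Ω : Type*} [m0 : MeasurableSpace Ω] (P : Measure Ω) [IsProbabilityMeasure P]
    (X : ℝ → ℕ → ℕ → Ω → ℝ) (C S0 : ℝ) (hC : 0 ≤ C) (hS0 : 0 ≤ S0)
    (hX : ∀ t : ℝ, 0 ≤ t → ∀ m n : ℕ, ∀ ω, 0 ≤ X t m n ω)
    (hm : ∀ t : ℝ, 0 ≤ t → ∀ m n : ℕ, m < n → Measurable (X t m n))
    (h1 : ∀ t : ℝ, 0 ≤ t → ∀ m k n : ℕ, m < k → k < n → ∀ ω,
      X t m n ω ≤ X t m k ω + X (t + X t m k ω) k n ω)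
    (h2 : ∀ ω, X 0 0 1 ω ≤ C)
    (h3 : ∀ t : ℝ, 0 ≤ t → ∀ m : ℕ,
      Measure.map (fun ω => fun j : ℕ => X t m (m + 1 + j) ω) P
        = Measure.map (fun ω => fun j : ℕ => X 0 0 (1 + j) ω) P)
    (shift : ∀ t : ℝ, 0 ≤ t → ∀ s, S0 ≤ s → ∀ m n : ℕ, m < n → ∀ ω,
      X t m n ω ≤ X (t + s) m n ω + s) :
    ∀ t : ℝ, 0 ≤ t → ∀ m n : ℕ, m < n → ∀ᵐ ω ∂P, X t m n ω ≤ (2 * C + S0) * ((n : ℝ) - m) := by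
  have base : ∀ t : ℝ, 0 ≤ t → ∀ m : ℕ, ∀ᵐ ω ∂P, X t m (m + 1) ω ≤ C := by
    intro t ht m
    have hB : MeasurableSet {x : ℕ → ℝ | x 0 ≤ C} :=
      measurableSet_le (measurable_pi_apply 0) measurable_const
    have e0 : ∀ᵐ x ∂(Measure.map (fun ω => fun j : ℕ => X 0 0 (1 + j) ω) P), x 0 ≤ C := by
      rw [ae_map_iff (measurable_pi_lambda _ (fun j => hm 0 le_rfl 0 (1 + j) (by omega))).aemeasurable hB]
      exact ae_of_all _ (fun ω => by simpa using h2 ω)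
    rw [← h3 t ht m, ae_map_iff (measurable_pi_lambda _
      (fun j => hm t ht m (m + 1 + j) (by omega))).aemeasurable hB] at e0
    simpa using e0
  have key : ∀ d : ℕ, ∀ t : ℝ, 0 ≤ t → ∀ m : ℕ,
      ∀ᵐ ω ∂P, X t m (m + d + 1) ω ≤ (2 * C + S0) * (d + 1) := by
    intro d
    induction d with
    | zero =>
      intro t ht m
      filter_upwards [base t ht m] with ω h
      simp only [Nat.add_zero, Nat.cast_zero]; linarith
    | succ d ih =>
      intro t ht m
      filter_upwards [base t ht m, ih (t + (C + S0)) (by linarith) (m + 1)] with ω ha hb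
      have e1 := h1 t ht m (m + 1) (m + (d + 1) + 1) (by omega) (by omega) ω
      have e2 := shift (t + X t m (m + 1) ω) (by linarith [hX t ht m (m+1) ω])
        (C + S0 - X t m (m + 1) ω) (by linarith) (m + 1) (m + (d + 1) + 1) (by omega) ω
      have e3 : t + X t m (m + 1) ω + (C + S0 - X t m (m + 1) ω) = t + (C + S0) := by ring
      rw [e3] at e2
      have e4 : m + 1 + d + 1 = m + (d + 1) + 1 := by ring
      rw [e4] at hb
      push_cast
      linarith [hX t ht m (m+1) ω]
  intro t ht m n hmn
  obtain ⟨d, rfl⟩ : ∃ d, n = m + d + 1 := ⟨n - m - 1, by omega⟩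
  filter_upwards [key d t ht m] with ω h
  push_cast
  have : ((m : ℝ) + d + 1 - m) = d + 1 := by ring
  rw [this]; exact h

section
variable {Ω : Type*} [m0 : MeasurableSpace Ω] {P : Measure Ω}
    {Fm Fp : ℝ → MeasurableSpace Ω} {X : ℝ → ℕ → ℕ → Ω → ℝ} {K S0 : ℝ} {φ : ℝ → ℝ}

theorem chain (H : NSys P Fm Fp X K S0 φ) (S : ℕ) (hS : S0 ≤ S) (m n : ℕ) (hm : 0 < m)
    (hmn : m < n) (ω : Ω) :
    X 0 0 n ω ≤ X 0 0 m ω + 1 + S + X ((⌈X 0 0 m ω⌉₊ + S : ℕ) : ℝ) m n ω := by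
  have h1 := H.sub 0 le_rfl 0 m n hm hmn ω
  have hx := H.nonneg 0 le_rfl 0 m ω
  have hc1 := Nat.le_ceil (X 0 0 m ω)
  have hc2 := Nat.ceil_lt_add_one hx
  have h2 := H.shift (0 + X 0 0 m ω) (by linarith) (⌈X 0 0 m ω⌉₊ - X 0 0 m ω + S)
    (by linarith) m n hmn ω
  have e : 0 + X 0 0 m ω + (⌈X 0 0 m ω⌉₊ - X 0 0 m ω + S) = ((⌈X 0 0 m ω⌉₊ + S : ℕ) : ℝ) := by
    push_cast; ring
  rw [e] at h2
  linarith

theorem bdd_all (H : NSys P Fm Fp X K S0 φ) :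
    ∀ᵐ ω ∂P, ∀ t m n : ℕ, m < n → X (t : ℝ) m n ω ≤ K * ((n : ℝ) - m) := by
  rw [ae_all_iff]; intro t
  rw [ae_all_iff]; intro m
  rw [ae_all_iff]; intro n
  by_cases h : m < n
  · filter_upwards [H.bdd t (Nat.cast_nonneg t) m n h] with ω hω _ using hω
  · exact ae_of_all _ (fun ω hh => absurd hh h)

def ff (X : ℝ → ℕ → ℕ → Ω → ℝ) (N a : ℕ) (ω : Ω) : ℝ := if a = 0 then 0 else X 0 0 (a * N) ω

theorem ff_nonneg (H : NSys P Fm Fp X K S0 φ) (N a : ℕ) (ω : Ω) : 0 ≤ ff X N a ω := by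
  unfold ff; split_ifs
  · exact le_rfl
  · exact H.nonneg 0 le_rfl _ _ _

theorem ff_chain (H : NSys P Fm Fp X K S0 φ) (S : ℕ) (hS : S0 ≤ S) (N : ℕ) (hN : 0 < N)
    (a k : ℕ) (hk : 0 < k) (ω : Ω) :
    ff X N (a + k) ω ≤ ff X N a ω + 1 + S
      + X ((⌈ff X N a ω⌉₊ + S : ℕ) : ℝ) (a * N) (a * N + k * N) ω := by
  rcases Nat.eq_zero_or_pos a with rfl | ha
  · have h := H.shift 0 le_rfl S hS 0 (k * N) (Nat.mul_pos hk hN) ω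
    have hk' : k ≠ 0 := hk.ne'
    simp only [ff, hk', zero_add, if_true, if_false, Nat.ceil_zero, zero_mul] at h ⊢
    linarith
  · have ha' : a ≠ 0 := ha.ne'
    have hak : a + k ≠ 0 := by omega
    have := H.chain S hS (a * N) (a * N + k * N) (Nat.mul_pos ha hN)
      (Nat.lt_add_of_pos_right (Nat.mul_pos hk hN)) ω
    simp only [ff, ha', hak, if_false, add_mul]
    exact this

def SA (α : ℝ) : Set (ℕ → ℝ) := {x | ∃ D : ℕ, ∃ᶠ j : ℕ in atTop, x j ≤ α * j + D}

theorem SA_meas (α : ℝ) : MeasurableSet (SA α) := by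
  unfold SA
  simp only [frequently_atTop, Set.ofPred_exists, Set.ofPred_forall]
  refine MeasurableSet.iUnion fun D => MeasurableSet.iInter fun a => MeasurableSet.iUnion fun b => ?_
  have : MeasurableSet {x : ℕ → ℝ | x b ≤ α * b + D} :=
    measurableSet_le (measurable_pi_apply b) measurable_const
  exact (MeasurableSet.const (b ≥ a)).inter this

def sq (X : ℝ → ℕ → ℕ → Ω → ℝ) (t : ℝ) (m : ℕ) (ω : Ω) : ℕ → ℝ := fun j => X t m (m + 1 + j) ω

theorem sq_measp (H : NSys P Fm Fp X K S0 φ) (t : ℝ) (ht : 0 ≤ t) (m : ℕ) :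
    Measurable[Fp t] (sq X t m) :=
  @measurable_pi_lambda Ω ℕ _ (Fp t) _ _ (fun j => H.measp t ht m (m + 1 + j) (by omega))

theorem sq_meas (H : NSys P Fm Fp X K S0 φ) (t : ℝ) (ht : 0 ≤ t) (m : ℕ) :
    Measurable (sq X t m) := (H.sq_measp t ht m).mono (H.Fp_le t ht) le_rfl

theorem X_meas (H : NSys P Fm Fp X K S0 φ) (t : ℝ) (ht : 0 ≤ t) (m n : ℕ) (h : m < n) :
    Measurable (X t m n) := (H.measp t ht m n h).mono (H.Fp_le t ht) le_rfl

theorem law_eq (H : NSys P Fm Fp X K S0 φ) (t : ℝ) (ht : 0 ≤ t) (m : ℕ) (B : Set (ℕ → ℝ))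
    (hB : MeasurableSet B) : P (sq X t m ⁻¹' B) = P (sq X 0 0 ⁻¹' B) := by
  rw [← Measure.map_apply (H.sq_meas t ht m) hB, ← Measure.map_apply (H.sq_meas 0 le_rfl 0) hB]
  have h1 := H.law t ht m
  have h2 := H.law 0 le_rfl 0
  have : Measure.map (sq X t m) P = Measure.map (sq X 0 0) P := h1.trans h2.symm
  rw [this]

theorem ae_shift (H : NSys P Fm Fp X K S0 φ) [IsProbabilityMeasure P] (α : ℝ) (s : ℕ) (hs : S0 ≤ s) :
    sq X s 0 ⁻¹' SA α =ᵐ[P] sq X 0 0 ⁻¹' SA α := by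
  apply ae_eq_of_subset_of_measure_ge
  · rintro ω ⟨D, hD⟩
    refine ⟨D + s, hD.mono fun j hj => ?_⟩
    have := H.shift 0 le_rfl s hs 0 (0 + 1 + j) (by omega) ω
    simp only [sq, zero_add] at this hj ⊢
    push_cast
    linarith
  · exact (H.law_eq s (Nat.cast_nonneg _) 0 _ (SA_meas α)).ge
  · exact (H.sq_meas s (Nat.cast_nonneg _) 0 (SA_meas α)).nullMeasurableSet
  · exact measure_ne_top _ _

theorem indep_k (H : NSys P Fm Fp X K S0 φ) [IsProbabilityMeasure P] (α : ℝ) (k : ℕ) (E : Set Ω)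
    (hE : MeasurableSet[Fm k] E) :
    P.real (sq X 0 0 ⁻¹' SA α ∩ E) = P.real (sq X 0 0 ⁻¹' SA α) * P.real E := by
  set A := sq X 0 0 ⁻¹' SA α with hA
  have hlim : Tendsto (fun j : ℕ => φ (j : ℝ) * P.real E) atTop (nhds (0 * P.real E)) :=
    (H.decay.comp tendsto_natCast_atTop_atTop).mul_const _
  rw [zero_mul] at hlim
  have hle : ∀ᶠ j : ℕ in atTop, |P.real (A ∩ E) - P.real A * P.real E| ≤ φ (j : ℝ) * P.real E := by
    filter_upwards [tendsto_natCast_atTop_atTop.eventually_ge_atTop S0] with j hj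
    have hjk : S0 ≤ ((k + j : ℕ) : ℝ) := by push_cast; linarith [(Nat.cast_nonneg k : (0:ℝ) ≤ k)]
    have hae := H.ae_shift α (k + j) hjk
    have hm := H.mix j (Nat.cast_nonneg _) k (Nat.cast_nonneg _) E
      (sq X ((k + j : ℕ) : ℝ) 0 ⁻¹' SA α) hE (by
        have := H.sq_measp ((k + j : ℕ) : ℝ) (Nat.cast_nonneg _) 0 (SA_meas α)
        have e : ((k + j : ℕ) : ℝ) = k + j := by push_cast; ring
        rw [e] at this ⊢; exact this)
    have e1 : P.real (sq X ((k + j : ℕ) : ℝ) 0 ⁻¹' SA α) = P.real A := measureReal_congr hae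
    have e2 : P.real (sq X ((k + j : ℕ) : ℝ) 0 ⁻¹' SA α ∩ E) = P.real (A ∩ E) :=
      measureReal_congr (hae.inter (ae_eq_refl E))
    rw [e1, e2] at hm
    exact hm
  have := ge_of_tendsto hlim hle
  have := abs_nonpos_iff.1 this
  linarith

theorem zero_one (H : NSys P Fm Fp X K S0 φ) [IsProbabilityMeasure P] (α : ℝ) :
    P (sq X 0 0 ⁻¹' SA α) = 0 ∨ P (sq X 0 0 ⁻¹' SA α) = 1 := by
  set A := sq X 0 0 ⁻¹' SA α with hA
  have hAm : MeasurableSet A := H.sq_meas 0 le_rfl 0 (SA_meas α)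
  have hAsup : MeasurableSet[⨆ k : ℕ, Fm k] A := by
    have : Measurable[⨆ k : ℕ, Fm k] (sq X 0 0) := by
      refine @measurable_pi_lambda Ω ℕ _ (⨆ k : ℕ, Fm k) _ _ (fun j => ?_)
      refine @measurable_of_Iic ℝ Ω _ _ _ (⨆ k : ℕ, Fm k) _ _ _ _ (fun x => ?_)
      by_cases hx : 0 ≤ x
      · have h1 := H.measm 0 le_rfl 0 (0 + 1 + j) (by omega) x hx
        rw [zero_add] at h1
        exact (le_iSup (fun k : ℕ => Fm k) ⌈x⌉₊) _ (H.Fm_mono x _ hx (Nat.le_ceil x) _ h1)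
      · have : (fun ω => sq X 0 0 ω j) ⁻¹' Set.Iic x = (∅ : Set Ω) := by
          ext ω
          have := H.nonneg 0 le_rfl 0 (0 + 1 + j) ω
          simp only [sq, Set.mem_preimage, Set.mem_Iic, Set.mem_empty_iff_false, iff_false]
          linarith
        rw [this]
        exact @MeasurableSet.empty Ω (⨆ k : ℕ, Fm k)
    exact this (SA_meas α)
  have hg : MeasurableSpace.generateFrom {A} ≤ m0 :=
    MeasurableSpace.generateFrom_le (by rintro _ rfl; exact hAm)
  have hI : ProbabilityTheory.Indep (⨆ k : ℕ, Fm k) (MeasurableSpace.generateFrom {A}) P := by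
    apply ProbabilityTheory.indep_iSup_of_monotone
    · intro k
      refine ProbabilityTheory.IndepSets.indep (p1 := {s | MeasurableSet[Fm k] s}) (p2 := {A})
        (H.Fm_le k (Nat.cast_nonneg _)) hg (@MeasurableSpace.isPiSystem_measurableSet Ω (Fm k))
        (IsPiSystem.singleton A) (@MeasurableSpace.generateFrom_measurableSet Ω (Fm k)).symm rfl ?_
      rw [ProbabilityTheory.IndepSets_iff]
      rintro E _ hE rfl
      have := H.indep_k α k E hE
      rw [Set.inter_comm, mul_comm]
      rw [Measure.real, Measure.real, Measure.real, ← ENNReal.toReal_mul] at this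
      exact (ENNReal.toReal_eq_toReal_iff' (measure_ne_top _ _)
        (ENNReal.mul_ne_top (measure_ne_top _ _) (measure_ne_top _ _))).1 this
    · intro k; exact H.Fm_le k (Nat.cast_nonneg _)
    · exact hg
    · intro i j hij; exact H.Fm_mono i j (Nat.cast_nonneg _) (by exact_mod_cast hij)
  have hS : ProbabilityTheory.IndepSet A A P := by
    apply hI.indepSet_of_measurableSet hAsup
    exact MeasurableSpace.measurableSet_generateFrom rfl
  exact ProbabilityTheory.measure_eq_zero_or_one_of_indepSet_self hS
end

theorem cover (f : ℕ → ℝ) (g : ℕ → ℝ) (b k : ℝ) (hb : 0 ≤ b) (hk : 0 ≤ k) (M : ℕ)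
    (hg0 : ∀ a, 0 ≤ g a)
    (h1 : ∀ a, g a < 1 → ∃ r : ℕ, 1 ≤ r ∧ r ≤ M ∧ f (a + r) ≤ f a + b * r)
    (h2 : ∀ a, f (a + 1) ≤ f a + k) :
    ∀ d a : ℕ, f (a + d) ≤ f a + b * d + k * (∑ i ∈ Finset.range d, g (a + i) + M) := by
  have h3 : ∀ d a : ℕ, f (a + d) ≤ f a + k * d := by
    intro d
    induction d with
    | zero => intro a; simp
    | succ d ih =>
      intro a
      have e1 := ih a
      have e2 := h2 (a + d)
      rw [← add_assoc]; push_cast; linarith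
  intro d
  induction d using Nat.strong_induction_on with
  | _ d ih =>
    intro a
    have hsum : ∀ r ≤ d, ∑ i ∈ Finset.range (d - r), g (a + r + i)
        + ∑ i ∈ Finset.range r, g (a + i) = ∑ i ∈ Finset.range d, g (a + i) := by
      intro r hr
      obtain ⟨e, rfl⟩ := Nat.exists_eq_add_of_le hr
      rw [Finset.sum_range_add, add_comm]
      simp [add_assoc]
    have hnn : ∀ r, 0 ≤ ∑ i ∈ Finset.range r, g (a + i) := fun r =>
      Finset.sum_nonneg (fun i _ => hg0 _)
    rcases Nat.eq_zero_or_pos d with rfl | hd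
    · simp; positivity
    by_cases hga : g a < 1
    · obtain ⟨r, hr1, hrM, hr⟩ := h1 a hga
      by_cases hrd : r ≤ d
      · have e := ih (d - r) (by omega) (a + r)
        have e' : a + r + (d - r) = a + d := by omega
        rw [e', Nat.cast_sub hrd] at e
        have := hsum r hrd
        have h0 := mul_nonneg hk (hnn r)
        rw [← this]
        nlinarith
      · have e := h3 d a
        have h0 := mul_nonneg hk (hnn d)
        have hdM : (d : ℝ) ≤ M := by exact_mod_cast (by omega)
        have h5 := mul_le_mul_of_nonneg_left hdM hk
        have h6 : 0 ≤ b * d := by positivity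
        nlinarith
    · have e := ih (d - 1) (by omega) (a + 1)
      have e' : a + 1 + (d - 1) = a + d := by omega
      rw [e', Nat.cast_sub hd] at e
      have := hsum 1 hd
      simp only [Finset.sum_range_one, add_zero] at this
      have h5 := mul_le_mul_of_nonneg_left (not_lt.1 hga) hk
      have h6 := h2 a
      rw [← this]
      push_cast at e
      nlinarith

section
variable {Ω : Type*} [m0 : MeasurableSpace Ω] {P : Measure Ω}
    {Fm Fp : ℝ → MeasurableSpace Ω} {X : ℝ → ℕ → ℕ → Ω → ℝ} {K S0 : ℝ} {φ : ℝ → ℝ}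

def BS (β : ℝ) (N M : ℕ) : Set (ℕ → ℝ) :=
  {x | ∀ r : ℕ, 1 ≤ r → r ≤ M → β * r * N < x (r * N - 1)}

theorem BS_meas (β : ℝ) (N M : ℕ) : MeasurableSet (BS β N M) := by
  unfold BS
  simp only [Set.ofPred_forall]
  refine MeasurableSet.iInter fun r => MeasurableSet.iInter fun _ => MeasurableSet.iInter fun _ => ?_
  exact measurableSet_lt measurable_const (measurable_pi_apply _)

theorem hit (H : NSys P Fm Fp X K S0 φ) [IsProbabilityMeasure P] (α β : ℝ) (hα : 0 ≤ α)
    (hβ : α < β) (hA : P (sq X 0 0 ⁻¹' SA α) = 1) (N : ℕ) (hN : 0 < N) :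
    ∀ᵐ ω ∂P, ∃ r : ℕ, 1 ≤ r ∧ X 0 0 (r * N) ω ≤ β * r * N := by
  have hA' : ∀ᵐ ω ∂P, ω ∈ sq X 0 0 ⁻¹' SA α := by
    rw [← prob_compl_eq_zero_iff (H.sq_meas 0 le_rfl 0 (SA_meas α))] at hA
    exact hA
  filter_upwards [hA', H.bdd_all] with ω h1 h2
  obtain ⟨D, hD⟩ := h1
  set S := ⌈S0⌉₊
  have hS : S0 ≤ S := Nat.le_ceil _
  have hev : ∀ᶠ j : ℕ in atTop, (D + 1 + S + K * N) / (β - α) ≤ (j : ℝ) :=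
    tendsto_natCast_atTop_atTop.eventually_ge_atTop _
  obtain ⟨j, hj, hj2⟩ := (hD.and_eventually hev).exists
  rw [div_le_iff₀ (by linarith)] at hj2
  simp only [sq, zero_add] at hj
  refine ⟨(1 + j) / N + 1, Nat.le_add_left _ _, ?_⟩
  have g1 : 1 + j < ((1 + j) / N + 1) * N := by
    have := Nat.lt_mul_div_succ (1 + j) hN
    rwa [mul_comm] at this
  have g2 : ((1 + j) / N + 1) * N ≤ 1 + j + N := by
    rw [add_mul, one_mul]; gcongr; exact Nat.div_mul_le_self _ _
  set n := ((1 + j) / N + 1) * N with hn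
  have c1 := H.chain S hS (1 + j) n (by omega) g1 ω
  have c2 := h2 (⌈X 0 0 (1 + j) ω⌉₊ + S) (1 + j) n g1
  have g1' : ((1 + j : ℕ) : ℝ) ≤ n := by exact_mod_cast g1.le
  have g2' : (n : ℝ) ≤ (1 + j : ℕ) + N := by exact_mod_cast g2
  have hK := H.Knn
  have c3 : K * ((n : ℝ) - (1 + j : ℕ)) ≤ K * N := by gcongr; linarith
  have c4 : β * j ≤ β * n := by
    have : 0 ≤ β := by linarith
    gcongr
    push_cast at g1'; linarith
  have c5 : β * ((1 + j) / N + 1 : ℕ) * N = β * n := by rw [hn]; push_cast; ring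
  rw [c5]
  nlinarith

theorem exM (H : NSys P Fm Fp X K S0 φ) [IsProbabilityMeasure P] (α β : ℝ) (hα : 0 ≤ α)
    (hβ : α < β) (hA : P (sq X 0 0 ⁻¹' SA α) = 1) (N : ℕ) (hN : 0 < N) (ε : ℝ) (hε : 0 < ε) :
    ∃ M : ℕ, P.real (sq X 0 0 ⁻¹' BS β N M) ≤ ε := by
  have hm : ∀ M, MeasurableSet (sq X 0 0 ⁻¹' BS β N M) := fun M =>
    H.sq_meas 0 le_rfl 0 (BS_meas β N M)
  have ht : Tendsto (fun M => P (sq X 0 0 ⁻¹' BS β N M)) atTop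
      (nhds (P (⋂ M, sq X 0 0 ⁻¹' BS β N M))) := by
    apply tendsto_measure_iInter_atTop (fun M => (hm M).nullMeasurableSet)
    · intro M M' h ω hω r h1 h2
      exact hω r h1 (h2.trans h)
    · exact ⟨0, measure_ne_top _ _⟩
  have hz : P (⋂ M, sq X 0 0 ⁻¹' BS β N M) = 0 := by
    rw [measure_eq_zero_iff_ae_notMem]
    filter_upwards [H.hit α β hα hβ hA N hN] with ω ⟨r, hr, hx⟩ hmem
    have := Set.mem_iInter.1 hmem r r hr le_rfl
    have hpos := Nat.mul_pos hr hN
    have e : 0 + 1 + (r * N - 1) = r * N := by omega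
    simp only [sq, e] at this
    linarith
  rw [hz] at ht
  obtain ⟨M, hM⟩ := (ht.eventually_le_const (ENNReal.ofReal_pos.2 hε)).exists
  exact ⟨M, ENNReal.toReal_le_of_le_ofReal hε.le hM⟩

theorem ff_measm (H : NSys P Fm Fp X K S0 φ) (N : ℕ) (hN : 0 < N) (a j : ℕ) :
    MeasurableSet[Fm j] {ω | ⌈ff X N a ω⌉₊ = j} := by
  have h1 : ∀ i : ℕ, MeasurableSet[Fm i] {ω | ⌈ff X N a ω⌉₊ ≤ i} := by
    intro i
    simp only [Nat.ceil_le, ff]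
    by_cases ha : a = 0
    · simp [ha]
    · simp only [ha, if_false]
      have := H.measm 0 le_rfl 0 (a * N) (Nat.mul_pos (Nat.pos_of_ne_zero ha) hN) i
        (Nat.cast_nonneg _)
      rwa [zero_add] at this
  cases j with
  | zero => simpa using h1 0
  | succ j =>
    have e : {ω | ⌈ff X N a ω⌉₊ = j + 1} = {ω | ⌈ff X N a ω⌉₊ ≤ j + 1} \ {ω | ⌈ff X N a ω⌉₊ ≤ j} := by
      ext ω; simp only [Set.mem_ofPred_eq, Set.mem_sdiff]; omega
    rw [e]
    exact (h1 (j + 1)).diff (H.Fm_mono j _ (Nat.cast_nonneg _) (by push_cast; linarith) _ (h1 j))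

theorem phi_nonneg (H : NSys P Fm Fp X K S0 φ) [IsProbabilityMeasure P] (s : ℝ) (hs : 0 ≤ s) :
    0 ≤ φ s := by
  have := H.mix s hs 0 le_rfl Set.univ Set.univ MeasurableSet.univ MeasurableSet.univ
  simp at this
  exact this

def Bd (X : ℝ → ℕ → ℕ → Ω → ℝ) (β : ℝ) (N M S a : ℕ) : Set Ω :=
  {ω | sq X ((⌈ff X N a ω⌉₊ + S : ℕ) : ℝ) (a * N) ω ∈ BS β N M}

theorem Bd_eq {Ω : Type*} {X : ℝ → ℕ → ℕ → Ω → ℝ} (β : ℝ) (N M S a : ℕ) :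
    Bd X β N M S a = ⋃ j : ℕ, (sq X ((j + S : ℕ) : ℝ) (a * N) ⁻¹' BS β N M)
      ∩ {ω | ⌈ff X N a ω⌉₊ = j} := by
  ext ω
  simp [Bd]

theorem Bd_meas (H : NSys P Fm Fp X K S0 φ) (β : ℝ) (N : ℕ) (hN : 0 < N) (M S a : ℕ) :
    MeasurableSet (Bd X β N M S a) := by
  rw [Bd_eq]
  exact MeasurableSet.iUnion fun j => (H.sq_meas _ (Nat.cast_nonneg _) _ (BS_meas β N M)).inter
    (H.Fm_le j (Nat.cast_nonneg _) _ (H.ff_measm N hN a j))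

theorem Bd_prob (H : NSys P Fm Fp X K S0 φ) [IsProbabilityMeasure P] (β : ℝ) (N : ℕ) (hN : 0 < N)
    (M S a : ℕ) :
    P.real (Bd X β N M S a) ≤ P.real (sq X 0 0 ⁻¹' BS β N M) + φ S := by
  set p := P.real (sq X 0 0 ⁻¹' BS β N M) with hp
  have hφ := H.phi_nonneg S (Nat.cast_nonneg _)
  have hp0 : 0 ≤ p := measureReal_nonneg
  set E : ℕ → Set Ω := fun j => {ω | ⌈ff X N a ω⌉₊ = j} with hE
  set B : ℕ → Set Ω := fun j => sq X ((j + S : ℕ) : ℝ) (a * N) ⁻¹' BS β N M with hB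
  have hEm : ∀ j, MeasurableSet (E j) := fun j =>
    H.Fm_le j (Nat.cast_nonneg _) _ (H.ff_measm N hN a j)
  have hBp : ∀ j, P.real (B j) = p := fun j => by
    simp only [hp, hB, Measure.real]
    rw [H.law_eq _ (Nat.cast_nonneg _) (a * N) _ (BS_meas β N M)]
  have hj : ∀ j, P.real (B j ∩ E j) ≤ (p + φ S) * P.real (E j) := by
    intro j
    have := H.mix S (Nat.cast_nonneg _) j (Nat.cast_nonneg _) (E j) (B j) (H.ff_measm N hN a j) (by
      have := H.sq_measp ((j + S : ℕ) : ℝ) (Nat.cast_nonneg _) (a * N) (BS_meas β N M)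
      rwa [show (j : ℝ) + S = ((j + S : ℕ) : ℝ) by push_cast; ring])
    rw [hBp] at this
    have := (abs_le.1 this).2
    linarith
  set J := ⌈K * (a * N)⌉₊ + 1 with hJ
  have hae : Bd X β N M S a ≤ᵐ[P] ⋃ j ∈ Finset.range J, (B j ∩ E j) := by
    filter_upwards [H.bdd_all] with ω hω hmem
    refine Set.mem_biUnion (x := ⌈ff X N a ω⌉₊) ?_ ⟨hmem, rfl⟩
    rw [Finset.mem_coe, Finset.mem_range, hJ, Nat.lt_succ_iff]
    apply Nat.ceil_le_ceil
    unfold ff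
    split_ifs with h0
    · have := H.Knn; positivity
    · have := hω 0 0 (a * N) (Nat.mul_pos (Nat.pos_of_ne_zero h0) hN)
      push_cast at this
      linarith
  calc P.real (Bd X β N M S a) ≤ P.real (⋃ j ∈ Finset.range J, (B j ∩ E j)) :=
        ENNReal.toReal_mono (measure_ne_top _ _) (measure_mono_ae hae)
    _ ≤ ∑ j ∈ Finset.range J, P.real (B j ∩ E j) := measureReal_biUnion_finset_le _ _
    _ ≤ ∑ j ∈ Finset.range J, (p + φ S) * P.real (E j) := Finset.sum_le_sum fun j _ => hj j
    _ = (p + φ S) * P.real (⋃ j ∈ Finset.range J, E j) := by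
        rw [← Finset.mul_sum, measureReal_biUnion_finset _ (fun j _ => hEm j)]
        intro i _ j _ hij
        rw [Function.onFun, Set.disjoint_left]
        intro ω h1 h2
        exact hij (h1.symm.trans h2)
    _ ≤ (p + φ S) * 1 := by gcongr; exact measureReal_le_one
    _ = p + φ S := mul_one _

theorem X_int (H : NSys P Fm Fp X K S0 φ) [IsProbabilityMeasure P] (n : ℕ) (hn : 0 < n) :
    Integrable (X 0 0 n) P := by
  refine Integrable.of_bound (H.X_meas 0 le_rfl 0 n hn).aestronglyMeasurable (K * ((n : ℝ) - (0 : ℕ))) ?_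
  filter_upwards [H.bdd 0 le_rfl 0 n hn] with ω h
  rw [Real.norm_of_nonneg (H.nonneg 0 le_rfl 0 n ω)]
  exact h

theorem block (H : NSys P Fm Fp X K S0 φ) [IsProbabilityMeasure P] (β ε : ℝ) (hβ : 0 ≤ β)
    (hε : 0 < ε) (S : ℕ) (hS : S0 ≤ S) (N : ℕ) (hN : 0 < N) (hSN : S + 1 ≤ ε * N) (M : ℕ)
    (R : ℕ) (hR : 0 < R) :
    ∫ ω, X 0 0 (R * N) ω ∂P ≤ (β + ε) * N * R
      + (K + ε) * N * ((P.real (sq X 0 0 ⁻¹' BS β N M) + φ S) * R + M) := by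
  have hK := H.Knn
  set q := P.real (sq X 0 0 ⁻¹' BS β N M) + φ S with hq
  set G : ℕ → Ω → ℝ := fun i => (Bd X β N M S i).indicator 1 with hG
  have hGi : ∀ i, Integrable (G i) P := fun i =>
    (integrable_const (1 : ℝ)).indicator (H.Bd_meas β N hN M S i)
  have hpt : ∀ᵐ ω ∂P, X 0 0 (R * N) ω ≤ (β + ε) * N * R
      + (K + ε) * N * (∑ i ∈ Finset.range R, G i ω + M) := by
    filter_upwards [H.bdd_all] with ω hω
    have hc := cover (fun a => ff X N a ω) (fun i => G i ω) ((β + ε) * N) ((K + ε) * N)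
      (by positivity) (by positivity) M
      (fun a => Set.indicator_nonneg (fun _ _ => zero_le_one) _)
      (by
        intro a ha
        have hnb : ω ∉ Bd X β N M S a := by
          intro hb
          simp only [hG] at ha
          rw [Set.indicator_of_mem hb] at ha
          simp at ha
        simp only [Bd, BS, Set.mem_ofPred_eq, not_forall, not_lt] at hnb
        obtain ⟨r, hr1, hrM, hr⟩ := hnb
        refine ⟨r, hr1, hrM, ?_⟩
        have c := H.ff_chain S hS N hN a r hr1 ω
        have hpos := Nat.mul_pos hr1 hN
        have e : a * N + 1 + (r * N - 1) = a * N + r * N := by omega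
        simp only [sq, e] at hr
        have hr1' : (1 : ℝ) ≤ r := by exact_mod_cast hr1
        have : ε * N ≤ ε * N * r := le_mul_of_one_le_right (by positivity) hr1'
        nlinarith)
      (by
        intro a
        have c := H.ff_chain S hS N hN a 1 one_pos ω
        have c2 := hω (⌈ff X N a ω⌉₊ + S) (a * N) (a * N + 1 * N) (by omega)
        have e : ((a * N + 1 * N : ℕ) : ℝ) - (a * N : ℕ) = N := by push_cast; ring
        rw [e] at c2
        linarith)
      R 0
    simp only [zero_add] at hc
    have e1 : ff X N R ω = X 0 0 (R * N) ω := by simp [ff, hR.ne']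
    have e2 : ff X N 0 ω = 0 := by simp [ff]
    rw [e1, e2] at hc
    linarith
  have hsi : Integrable (fun ω => ∑ i ∈ Finset.range R, G i ω) P :=
    integrable_finsetSum _ (fun i _ => hGi i)
  have hsi2 : Integrable (fun ω => ∑ i ∈ Finset.range R, G i ω + (M : ℝ)) P :=
    hsi.add (integrable_const _)
  have hri : Integrable (fun ω => (β + ε) * N * R
      + (K + ε) * N * (∑ i ∈ Finset.range R, G i ω + M)) P :=
    (integrable_const _).add (hsi2.const_mul _)
  refine (integral_mono_ae (H.X_int _ (Nat.mul_pos hR hN)) hri hpt).trans ?_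
  rw [integral_add (integrable_const _) (hsi2.const_mul _),
    integral_const_mul ((K + ε) * N), integral_add hsi (integrable_const _), integral_finsetSum _ (fun i _ => hGi i)]
  simp only [integral_const, probReal_univ, smul_eq_mul, one_mul]
  have hs : ∑ i ∈ Finset.range R, ∫ ω, G i ω ∂P ≤ q * R := by
    calc ∑ i ∈ Finset.range R, ∫ ω, G i ω ∂P ≤ ∑ i ∈ Finset.range R, q := by
          apply Finset.sum_le_sum
          intro i _
          simp only [hG]
          rw [integral_indicator_one (H.Bd_meas β N hN M S i)]
          exact H.Bd_prob β N hN M S i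
      _ = q * R := by simp [mul_comm]
  gcongr
end

section
variable {Ω : Type*} [m0 : MeasurableSpace Ω] {P : Measure Ω}
    {Fm Fp : ℝ → MeasurableSpace Ω} {X : ℝ → ℕ → ℕ → Ω → ℝ} {K S0 : ℝ} {φ : ℝ → ℝ}

theorem upper (H : NSys P Fm Fp X K S0 φ) [IsProbabilityMeasure P] (α : ℝ) (hα : 0 ≤ α)
    (hA : P (sq X 0 0 ⁻¹' SA α) = 1) (e : ℝ) (he : 0 < e) :
    ∀ᶠ n : ℕ in atTop, (∫ ω, X 0 0 n ω ∂P) / n ≤ α + e := by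
  have hK := H.Knn
  set ε := min 1 (e / (5 + 2 * K)) with hεd
  have hε : 0 < ε := by positivity
  have hε1 : ε ≤ 1 := min_le_left _ _
  have hε2 : ε * (5 + 2 * K) ≤ e := by
    rw [← le_div_iff₀ (by positivity)]; exact min_le_right _ _
  have hev : ∀ᶠ S : ℕ in atTop, φ S ≤ ε :=
    (H.decay.comp tendsto_natCast_atTop_atTop).eventually_le_const hε
  obtain ⟨S, hφ, hS⟩ := (hev.and (tendsto_natCast_atTop_atTop.eventually_ge_atTop S0)).exists
  set N := ⌈(S + 1) / ε⌉₊ with hNd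
  have hN : 0 < N := Nat.ceil_pos.2 (by positivity)
  have hSN : S + 1 ≤ ε * N := by
    rw [mul_comm, ← div_le_iff₀ hε]; exact Nat.le_ceil _
  obtain ⟨M, hM⟩ := H.exM α (α + ε) hα (by linarith) hA N hN ε hε
  set Q := (K + ε) * N * M + 1 + S + K * N with hQ
  have hev2 : ∀ᶠ n : ℕ in atTop, Q / ε ≤ (n : ℝ) :=
    tendsto_natCast_atTop_atTop.eventually_ge_atTop _
  filter_upwards [hev2, eventually_ge_atTop N] with n hn hnN
  have hn0 : 0 < n := lt_of_lt_of_le hN hnN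
  have hn0' : (0 : ℝ) < n := by exact_mod_cast hn0
  rw [div_le_iff₀ hε] at hn
  have hR : 0 < n / N := Nat.div_pos hnN hN
  set R := n / N with hRd
  have hRN : R * N ≤ n := Nat.div_mul_le_self _ _
  have hRN2 : n < R * N + N := Nat.lt_div_mul_add hN
  have hRN' : (R : ℝ) * N ≤ n := by exact_mod_cast hRN
  have hRN2' : (n : ℝ) ≤ R * N + N := by exact_mod_cast hRN2.le
  have hb := H.block (α + ε) ε (by linarith) hε S hS N hN hSN M R hR
  have hle : ∀ᵐ ω ∂P, X 0 0 n ω ≤ X 0 0 (R * N) ω + (1 + S + K * N) := by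
    filter_upwards [H.bdd_all] with ω hω
    rcases hRN.eq_or_lt with h | h
    · rw [h]
      have : 0 ≤ 1 + S + K * N := by positivity
      linarith
    · have c1 := H.chain S hS (R * N) n (Nat.mul_pos hR hN) h ω
      have c2 := hω (⌈X 0 0 (R * N) ω⌉₊ + S) (R * N) n h
      have c3 : K * ((n : ℝ) - (R * N : ℕ)) ≤ K * N := by
        gcongr; push_cast; linarith
      linarith
  have hi := H.X_int (R * N) (Nat.mul_pos hR hN)
  have hint := integral_mono_ae (H.X_int n hn0) (hi.add (integrable_const _)) hle
  rw [integral_add' hi (integrable_const _)] at hint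
  simp only [integral_const, probReal_univ, smul_eq_mul, one_mul] at hint
  rw [div_le_iff₀ hn0']
  have hq : P.real (sq X 0 0 ⁻¹' BS (α + ε) N M) + φ S ≤ 2 * ε := by linarith
  have b1 : (α + ε + ε) * N * R ≤ (α + 2 * ε) * n := by
    have : (α + ε + ε) * N * R = (α + 2 * ε) * (R * N) := by ring
    rw [this]; gcongr
  have b2 : (K + ε) * N * ((P.real (sq X 0 0 ⁻¹' BS (α + ε) N M) + φ S) * R + M)
      ≤ (K + 1) * (2 * ε) * n + (K + ε) * N * M := by
    calc (K + ε) * N * ((P.real (sq X 0 0 ⁻¹' BS (α + ε) N M) + φ S) * R + M)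
        ≤ (K + ε) * N * ((2 * ε) * R + M) := by gcongr
      _ = (K + ε) * (2 * ε) * (R * N) + (K + ε) * N * M := by ring
      _ ≤ _ := by gcongr
  have b3 : ε * (5 + 2 * K) * n ≤ e * n := by gcongr
  nlinarith

theorem SA_mono {α β : ℝ} (h : α ≤ β) : SA α ⊆ SA β := by
  rintro x ⟨D, hD⟩
  exact ⟨D, hD.mono fun j hj => hj.trans (by gcongr)⟩

theorem concl (H : NSys P Fm Fp X K S0 φ) [IsProbabilityMeasure P] :
    ∃ L : ℝ,
      Tendsto (fun n : ℕ => (∫ ω, X 0 0 n ω ∂P) / n) atTop (nhds L) ∧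
      TendstoInMeasure P (fun n : ℕ => fun ω => X 0 0 n ω / n) atTop (fun _ => L) ∧
      ∀ᵐ ω ∂P, L ≤ liminf (fun n : ℕ => X 0 0 n ω / n) atTop := by
  have hK := H.Knn
  set T : Set ℝ := {α | P (sq X 0 0 ⁻¹' SA α) = 1} with hT
  have hTlow : ∀ α ∈ T, 0 ≤ α := by
    intro α hα
    by_contra hneg
    push Not at hneg
    have hemp : sq X 0 0 ⁻¹' SA α = ∅ := by
      ext ω
      simp only [Set.mem_preimage, Set.mem_empty_iff_false, iff_false]
      rintro ⟨D, hD⟩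
      obtain ⟨j, hj, hj2⟩ := (hD.and_eventually
        (tendsto_natCast_atTop_atTop.eventually_gt_atTop ((D : ℝ) / (-α)))).exists
      rw [div_lt_iff₀ (by linarith)] at hj2
      have := H.nonneg 0 le_rfl 0 (0 + 1 + j) ω
      simp only [sq] at hj
      linarith
    simp only [hT, Set.mem_ofPred_eq, hemp, measure_empty] at hα
    exact zero_ne_one hα
  have hTK : K ∈ T := by
    have : ∀ᵐ ω ∂P, ω ∈ sq X 0 0 ⁻¹' SA K := by
      filter_upwards [H.bdd_all] with ω hω
      refine ⟨⌈K⌉₊, Eventually.frequently (Eventually.of_forall fun j => ?_)⟩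
      have h1 := hω 0 0 (0 + 1 + j) (by omega)
      have h2 := Nat.le_ceil K
      simp only [sq]
      push_cast at h1 ⊢
      linarith
    exact (prob_compl_eq_zero_iff (H.sq_meas 0 le_rfl 0 (SA_meas K))).1 this
  have hTb : BddBelow T := ⟨0, hTlow⟩
  set L := sInf T with hL
  have hL0 : 0 ≤ L := le_csInf ⟨K, hTK⟩ hTlow
  have hup : ∀ e > 0, ∀ᶠ n : ℕ in atTop, (∫ ω, X 0 0 n ω ∂P) / n ≤ L + e := by
    intro e he
    obtain ⟨α, hαT, hα⟩ := exists_lt_of_csInf_lt ⟨K, hTK⟩ (show sInf T < L + e / 2 by linarith)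
    filter_upwards [H.upper α (hTlow α hαT) hαT (e / 2) (by linarith)] with n hn
    linarith
  -- lower bound almost surely
  have hlow1 : ∀ α < L, ∀ᵐ ω ∂P, ∀ᶠ n : ℕ in atTop, α ≤ X 0 0 n ω / n := by
    intro α hα
    have h0 : P (sq X 0 0 ⁻¹' SA α) = 0 := by
      rcases H.zero_one α with h | h
      · exact h
      · exact absurd (csInf_le hTb h) (not_le.2 hα)
    rw [measure_eq_zero_iff_ae_notMem] at h0
    filter_upwards [h0] with ω hω
    have hω' : ∀ D : ℕ, ¬ ∃ᶠ j : ℕ in atTop, sq X 0 0 ω j ≤ α * j + D := fun D hD => hω ⟨D, hD⟩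
    have := hω' ⌈α⌉₊
    rw [not_frequently] at this
    have h3 : ∀ᶠ n : ℕ in atTop, ¬ sq X 0 0 ω (n - 1) ≤ α * (n - 1 : ℕ) + ⌈α⌉₊ :=
      (tendsto_sub_atTop_nat 1).eventually this
    filter_upwards [h3, eventually_ge_atTop 1] with n hn hn1
    have e : 0 + 1 + (n - 1) = n := by omega
    simp only [sq, e, not_le] at hn
    rw [Nat.cast_sub hn1] at hn
    have h2 := Nat.le_ceil α
    rw [le_div_iff₀ (by exact_mod_cast hn1)]
    push_cast at hn
    nlinarith
  have hlow : ∀ᵐ ω ∂P, ∀ k : ℕ, ∀ᶠ n : ℕ in atTop, L - 1 / ((k : ℝ) + 1) ≤ X 0 0 n ω / n := by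
    rw [ae_all_iff]
    intro k
    exact hlow1 _ (by have : 0 < 1 / ((k : ℝ) + 1) := by positivity
                      linarith)
  have hlow' : ∀ᵐ ω ∂P, ∀ α < L, ∀ᶠ n : ℕ in atTop, α ≤ X 0 0 n ω / n := by
    filter_upwards [hlow] with ω hω α hα
    obtain ⟨k, hk⟩ := exists_nat_one_div_lt (sub_pos.2 hα)
    filter_upwards [hω k] with n hn
    linarith
  set a : ℕ → ℝ := fun n => (∫ ω, X 0 0 n ω ∂P) / n with ha
  set g : ℕ → Ω → ℝ := fun n ω => min (X 0 0 (n + 1) ω / ((n + 1 : ℕ) : ℝ)) L with hg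
  have hXd : ∀ n, Integrable (fun ω => X 0 0 (n + 1) ω / ((n + 1 : ℕ) : ℝ)) P := fun n =>
    (H.X_int (n + 1) (by omega)).div_const _
  have hXd0 : ∀ n ω, 0 ≤ X 0 0 (n + 1) ω / ((n + 1 : ℕ) : ℝ) := fun n ω =>
    div_nonneg (H.nonneg 0 le_rfl _ _ _) (Nat.cast_nonneg _)
  have hgi : ∀ n, Integrable (g n) P := fun n => (hXd n).inf (integrable_const L)
  have hgl : Tendsto (fun n => ∫ ω, g n ω ∂P) atTop (nhds L) := by
    have : Tendsto (fun n => ∫ ω, g n ω ∂P) atTop (nhds (∫ _, L ∂P)) := by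
      apply tendsto_integral_of_dominated_convergence (fun _ => L)
      · exact fun n => (hgi n).aestronglyMeasurable
      · exact integrable_const _
      · intro n
        refine ae_of_all _ fun ω => ?_
        rw [Real.norm_of_nonneg (le_min (hXd0 n ω) hL0)]
        exact min_le_right _ _
      · filter_upwards [hlow'] with ω hω
        refine tendsto_order.2 ⟨fun b hb => ?_, fun b hb => ?_⟩
        · have h1 := (tendsto_add_atTop_nat 1).eventually (hω ((b + L) / 2) (by linarith))
          filter_upwards [h1] with n hn
          exact lt_min (by linarith) hb
        · exact Eventually.of_forall fun n => (min_le_right _ _).trans_lt hb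
    simpa using this
  have hag : ∀ n, ∫ ω, g n ω ∂P ≤ a (n + 1) := by
    intro n
    simp only [ha]
    rw [← integral_div]
    exact integral_mono (hgi n) (hXd n) (fun ω => min_le_left _ _)
  have hal1 : Tendsto (fun n => a (n + 1)) atTop (nhds L) := by
    refine tendsto_order.2 ⟨fun b hb => ?_, fun b hb => ?_⟩
    · filter_upwards [hgl.eventually_const_lt hb] with n hn
      exact hn.trans_le (hag n)
    · have h1 := (tendsto_add_atTop_nat 1).eventually (hup ((b - L) / 2) (by linarith))
      filter_upwards [h1] with n hn
      simp only [ha]; linarith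
  have hal : Tendsto a atTop (nhds L) := (tendsto_add_atTop_iff_nat 1).1 hal1
  refine ⟨L, hal, ?_, ?_⟩
  · have hdm : ∀ n, AEStronglyMeasurable (fun ω => X 0 0 (n + 1) ω / ((n + 1 : ℕ) : ℝ)) P :=
      fun n => (hXd n).aestronglyMeasurable
    have hshift : TendstoInMeasure P (fun n : ℕ => fun ω => X 0 0 (n + 1) ω / ((n + 1 : ℕ) : ℝ))
        atTop (fun _ => L) := by
      apply tendstoInMeasure_of_tendsto_eLpNorm (p := 1) one_ne_zero hdm
        aestronglyMeasurable_const
      have hE : ∀ n, eLpNorm ((fun ω => X 0 0 (n + 1) ω / ((n + 1 : ℕ) : ℝ)) - fun _ => L) 1 P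
          = ENNReal.ofReal (a (n + 1) + L - 2 * ∫ ω, g n ω ∂P) := by
        intro n
        have hsub : Integrable ((fun ω => X 0 0 (n + 1) ω / ((n + 1 : ℕ) : ℝ)) - fun _ => L) P :=
          (hXd n).sub (integrable_const L)
        rw [eLpNorm_one_eq_lintegral_enorm, ← ofReal_integral_norm_eq_lintegral_enorm hsub]
        congr 1
        have : ∀ ω, ‖((fun ω => X 0 0 (n + 1) ω / ((n + 1 : ℕ) : ℝ)) - (fun _ => L) : Ω → ℝ) ω‖
            = X 0 0 (n + 1) ω / ((n + 1 : ℕ) : ℝ) + L - 2 * g n ω := by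
          intro ω
          simp only [Pi.sub_apply, Real.norm_eq_abs, hg]
          rcases le_total (X 0 0 (n + 1) ω / ((n + 1 : ℕ) : ℝ)) L with h | h
          · rw [min_eq_left h, abs_of_nonpos (by linarith)]; ring
          · rw [min_eq_right h, abs_of_nonneg (by linarith)]; ring
        simp_rw [this]
        have h1 : Integrable (fun ω => X 0 0 (n + 1) ω / ((n + 1 : ℕ) : ℝ) + L) P :=
          (hXd n).add (integrable_const L)
        rw [integral_sub h1 ((hgi n).const_mul 2), integral_add (hXd n) (integrable_const L),
          integral_const_mul, integral_div]
        simp [ha]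
      simp_rw [hE]
      have : Tendsto (fun n => a (n + 1) + L - 2 * ∫ ω, g n ω ∂P) atTop (nhds (L + L - 2 * L)) :=
        (hal1.add_const L).sub (hgl.const_mul 2)
      rw [show L + L - 2 * L = 0 by ring] at this
      simpa using ENNReal.tendsto_ofReal this
    intro e he
    exact (tendsto_add_atTop_iff_nat 1).1 (hshift e he)
  · filter_upwards [hlow', H.bdd_all] with ω hω hb
    have hcob : IsCoboundedUnder (· ≥ ·) atTop (fun n : ℕ => X 0 0 n ω / n) := by
      apply IsBoundedUnder.isCoboundedUnder_ge
      refine ⟨K, ?_⟩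
      rw [eventually_map]
      filter_upwards [eventually_ge_atTop 1] with n hn
      have h1 := hb 0 0 n hn
      rw [div_le_iff₀ (by exact_mod_cast hn)]
      push_cast at h1
      linarith
    refine le_of_forall_lt fun α hα => ?_
    exact lt_of_lt_of_le (show α < (α + L) / 2 by linarith)
      (le_liminf_of_le hcob (hω ((α + L) / 2) (by linarith)))
end

end NSys

/-- **Non-autonomous subadditive theorem (in-probability version).**
Under hypotheses (1)-(4) and (6) on the family `X_{m,n}^t`, and mere decay of the mixing
coefficient `φ`, the limit `L = lim E[X_{0,n}^0]/n` exists, `X_{0,n}^0/n → L` in probability,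
and `liminf X_{0,n}^0/n ≥ L` almost surely. -/
theorem nonautonomous_subadditive_in_probability
    {Ω : Type*} [m0 : MeasurableSpace Ω] (P : Measure Ω) [IsProbabilityMeasure P]
    (Fm Fp : ℝ → MeasurableSpace Ω)
    (hFm_le : ∀ t : ℝ, 0 ≤ t → Fm t ≤ m0) (hFp_le : ∀ t : ℝ, 0 ≤ t → Fp t ≤ m0)
    (hFm_mono : ∀ s t : ℝ, 0 ≤ s → s ≤ t → Fm s ≤ Fm t)
    (hFp_anti : ∀ s t : ℝ, 0 ≤ s → s ≤ t → Fp t ≤ Fp s)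
    (X : ℝ → ℕ → ℕ → Ω → ℝ)
    (hX_nonneg : ∀ t : ℝ, 0 ≤ t → ∀ m n : ℕ, ∀ ω, 0 ≤ X t m n ω)
    (C : ℝ) (hC : 0 ≤ C)
    -- (1) subadditivity along time shifts
    (h1 : ∀ t : ℝ, 0 ≤ t → ∀ m k n : ℕ, m < k → k < n → ∀ ω,
      X t m n ω ≤ X t m k ω + X (t + X t m k ω) k n ω)
    -- (2) boundedness of the basic block
    (h2 : ∀ ω, X 0 0 1 ω ≤ C)
    -- (3) the joint distribution of (X_{m,m+1}^t, X_{m,m+2}^t, ...) is independent of (t,m)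
    (h3 : ∀ t : ℝ, 0 ≤ t → ∀ m : ℕ,
      Measure.map (fun ω => fun j : ℕ => X t m (m + 1 + j) ω) P
        = Measure.map (fun ω => fun j : ℕ => X 0 0 (1 + j) ω) P)
    -- (4) measurability with respect to the filtrations
    (h4a : ∀ t : ℝ, 0 ≤ t → ∀ m n : ℕ, m < n → Measurable[Fp t] (X t m n))
    (h4b : ∀ t : ℝ, 0 ≤ t → ∀ m n : ℕ, m < n → ∀ s : ℝ, 0 ≤ s →
      MeasurableSet[Fm (t + s)] {ω | X t m n ω ≤ s})
    -- (6) approximate monotonicity in the starting time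
    (h6 : ∃ c : ℝ, 0 < c ∧ ∀ t : ℝ, 0 ≤ t → ∀ s ∈ Set.Icc C (C + c), ∀ m n : ℕ, m < n → ∀ ω,
      X t m n ω ≤ X (t + s) m n ω + s)
    -- (5) the mixing coefficient and its polynomial decay
    (φ : ℝ → ℝ)
    (hφ : ∀ s : ℝ, φ s = sSup {r | ∃ t : ℝ, 0 ≤ t ∧ ∃ Ev Fv : Set Ω,
      MeasurableSet[Fm t] Ev ∧ MeasurableSet[Fp (t + s)] Fv ∧ 0 < P Ev ∧
      r = |(P (Fv ∩ Ev)).toReal / (P Ev).toReal - (P Fv).toReal|})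
    (h5 : Tendsto φ atTop (nhds 0)) :
    ∃ L : ℝ,
      Tendsto (fun n : ℕ => (∫ ω, X 0 0 n ω ∂P) / n) atTop (nhds L) ∧
      TendstoInMeasure P (fun n : ℕ => fun ω => X 0 0 n ω / n) atTop (fun _ => L) ∧
      ∀ᵐ ω ∂P, L ≤ liminf (fun n : ℕ => X 0 0 n ω / n) atTop := by
  obtain ⟨c, hc, h6'⟩ := h6
  have hS0 : 0 ≤ C * (C + c) / c + c := by positivity
  have hsh := NSys.shift_of X C c hC hc h6'
  have H : NSys P Fm Fp X (2 * C + (C * (C + c) / c + c)) (C * (C + c) / c + c) φ :=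
    { Fm_le := hFm_le
      Fp_le := hFp_le
      Fm_mono := hFm_mono
      nonneg := hX_nonneg
      sub := h1
      law := h3
      measp := h4a
      measm := h4b
      S0nn := hS0
      Knn := by positivity
      shift := hsh
      bdd := NSys.bdd_of P X C _ hC hS0 hX_nonneg
        (fun t ht m n h => (h4a t ht m n h).mono (hFp_le t ht) le_rfl) h1 h2 h3 hsh
      mix := fun s _ t ht Ev Fv hE hF => NSys.mix_of P Fm Fp φ hφ s t ht Ev Fv hE hF
      decay := h5 }
  exact H.concl
end

section
/- (Mixing implies triviality of shift-invariant limits.) Let (Ω, F, P) be a probability space equipped with a group {Υ_{(s,y)}}_{(s,y)∈ℝ^{d+1}} of measure-preserving bijections satisfying Υ_{(0,0)} = id and Υ_{(s,y)}∘Υ_{(r,z)} = Υ_{(s+r,y+z)}, and with two families {F_t^-}_{t∈ℝ} (nondecreasing in t) and {F_t^+}_{t∈ℝ} (nonincreasing in t) of sub-σ-algebras of F whose mixing coefficient φ(s) := sup{ |P[F|E] − P[F]| : t ∈ ℝ, E ∈ F_t^-, F ∈ F_{t+s}^+, P[E] > 0 } satisfies lim_{s→∞} φ(s) = 0. Let F'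 be the σ-algebra generated by ∪_{i∈ℕ} (F_{-i}^+ ∩ F_i^-). Suppose X : Ω → [0,1] is F'-measurable, satisfies X∘Υ_{(s,0)} = X almost surely for every s ≥ 0, and there are random variables X_r : Ω → [0,1] (r > 0) with X_r → X almost surely as r → ∞ and such that for every r > 0 and t ∈ ℝ the function X_r∘Υ_{(r+t,0)} is F_t^+-measurable. Then X is almost surely constant, i.e., X = E[X] almost surely. -/
open MeasureTheory Filter

/-- **Mixing implies triviality of shift-invariant limits.**  If the mixing coefficient of the
two filtrations tends to `0`, then any `[0,1]`-valued `F'`-measurable random variable `X` that is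
invariant under the time shifts `Υ_{(s,0)}` and is an a.s. limit of random variables `X_r` with
`X_r ∘ Υ_{(r+t,0)}` being `F_t^+`-measurable, is almost surely constant (equal to its mean). -/
theorem mixing_shift_invariant_trivial
    {d : ℕ} {Ω : Type*} [m0 : MeasurableSpace Ω] (P : Measure Ω) [IsProbabilityMeasure P]
    (Υ : ℝ × EuclideanSpace ℝ (Fin d) → Ω → Ω)
    (hmp : ∀ p, MeasurePreserving (Υ p) P P)
    (hid : Υ 0 = id)
    (hgrp : ∀ p q, Υ p ∘ Υ q = Υ (p + q))
    (Fm Fp : ℝ → MeasurableSpace Ω)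
    (hFm_le : ∀ t : ℝ, Fm t ≤ m0) (hFp_le : ∀ t : ℝ, Fp t ≤ m0)
    (hFm_mono : Monotone Fm) (hFp_anti : Antitone Fp)
    (φ : ℝ → ℝ)
    (hφ : ∀ s : ℝ, φ s = sSup {r | ∃ t : ℝ, ∃ Ev Fv : Set Ω,
      MeasurableSet[Fm t] Ev ∧ MeasurableSet[Fp (t + s)] Fv ∧ 0 < P Ev ∧
      r = |(P (Fv ∩ Ev)).toReal / (P Ev).toReal - (P Fv).toReal|})
    (hmix : Tendsto φ atTop (nhds 0))
    (F' : MeasurableSpace Ω) (hF' : F' = ⨆ i : ℕ, (Fp (-(i : ℝ)) ⊓ Fm (i : ℝ)))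
    (X : Ω → ℝ) (hXmeas : Measurable[F'] X)
    (hX0 : ∀ ω, 0 ≤ X ω) (hX1 : ∀ ω, X ω ≤ 1)
    (hinv : ∀ s : ℝ, 0 ≤ s → (fun ω => X (Υ (s, 0) ω)) =ᵐ[P] X)
    (Xr : ℝ → Ω → ℝ)
    (hXr0 : ∀ r : ℝ, 0 < r → ∀ ω, 0 ≤ Xr r ω) (hXr1 : ∀ r : ℝ, 0 < r → ∀ ω, Xr r ω ≤ 1)
    (hconv : ∀ᵐ ω ∂P, Tendsto (fun r : ℝ => Xr r ω) atTop (nhds (X ω)))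
    (hXrmeas : ∀ r : ℝ, 0 < r → ∀ t : ℝ, Measurable[Fp t] (fun ω => Xr r (Υ (r + t, 0) ω))) :
    X =ᵐ[P] fun _ => ∫ ω, X ω ∂P := by
  classical
  subst hF'
  have hF'le : (⨆ i : ℕ, (Fp (-(i : ℝ)) ⊓ Fm (i : ℝ))) ≤ m0 := by
    exact iSup_le fun i => inf_le_left.trans (hFp_le _)
  have hXm : Measurable X := hXmeas.mono hF'le le_rfl
  -- a version of X measurable w.r.t. each Fp t
  have key : ∀ t : ℝ, ∃ Y : Ω → ℝ, Measurable[Fp t] Y ∧ Y =ᵐ[P] X := by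
    intro t
    have hrpos : ∀ n : ℕ, (0 : ℝ) < (n : ℝ) + 1 := fun n => by positivity
    have hXrm : ∀ n : ℕ, Measurable (Xr ((n : ℝ) + 1)) := by
      intro n
      have h := (hXrmeas _ (hrpos n) (-((n : ℝ) + 1))).mono (hFp_le _) le_rfl
      have e : (((n : ℝ) + 1 + -((n : ℝ) + 1), 0) : ℝ × EuclideanSpace ℝ (Fin d)) = 0 := by
        rw [add_neg_cancel]; rfl
      rw [e, hid] at h
      exact h
    have hlim : Tendsto (fun n : ℕ => (n : ℝ) + 1) atTop atTop :=
      tendsto_atTop_add_const_right _ _ tendsto_natCast_atTop_atTop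
    have h1 : TendstoInMeasure P (fun n : ℕ => Xr ((n : ℝ) + 1)) atTop X := by
      apply tendstoInMeasure_of_tendsto_ae (fun n => (hXrm n).aestronglyMeasurable)
      filter_upwards [hconv] with ω hω
      exact hω.comp hlim
    have h2 : TendstoInMeasure P
        (fun (n : ℕ) ω => Xr ((n : ℝ) + 1) (Υ ((n : ℝ) + 1 + t, 0) ω)) atTop X := by
      intro ε hε
      refine (h1 ε hε).congr' ?_
      filter_upwards [hlim.eventually_ge_atTop (-t)] with n hn
      have hs : 0 ≤ (n : ℝ) + 1 + t := by linarith
      have hmeas : MeasurableSet {x | ε ≤ edist (Xr ((n : ℝ) + 1) x) (X x)} :=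
        measurableSet_le measurable_const ((hXrm n).edist hXm)
      rw [← (hmp ((n : ℝ) + 1 + t, 0)).measure_preimage hmeas.nullMeasurableSet]
      apply measure_congr
      filter_upwards [hinv _ hs] with ω hω
      apply propext
      change ε ≤ edist _ (X (Υ ((n : ℝ) + 1 + t, 0) ω)) ↔ ε ≤ edist _ (X ω)
      rw [hω]
    obtain ⟨ns, -, hns⟩ := h2.exists_seq_tendsto_ae
    refine ⟨fun ω => limsup (fun i => Xr ((ns i : ℝ) + 1) (Υ ((ns i : ℝ) + 1 + t, 0) ω)) atTop,
      ?_, ?_⟩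
    · exact Measurable.limsup (mδ := Fp t)
        (fun i => hXrmeas _ (hrpos (ns i)) t)
    · filter_upwards [hns] with ω hω
      exact hω.limsup_eq
  have hbound : ∀ (t s : ℝ) (Ev Fv : Set Ω), MeasurableSet[Fm t] Ev →
      MeasurableSet[Fp (t + s)] Fv → 0 < P Ev →
      |(P (Fv ∩ Ev)).toReal / (P Ev).toReal - (P Fv).toReal| ≤ φ s := by
    intro t s Ev Fv hE hF hpos
    rw [hφ]
    refine le_csSup ⟨1, ?_⟩ ⟨t, Ev, Fv, hE, hF, hpos, rfl⟩
    rintro r ⟨t, E, F, -, -, -, rfl⟩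
    have a1 : (P (F ∩ E)).toReal / (P E).toReal ≤ 1 :=
      div_le_one_of_le₀ (measureReal_mono (μ := P) Set.inter_subset_right) ENNReal.toReal_nonneg
    have a0 : 0 ≤ (P (F ∩ E)).toReal / (P E).toReal := by positivity
    have b1 : (P F).toReal ≤ 1 := measureReal_le_one (μ := P)
    have b0 : 0 ≤ (P F).toReal := ENNReal.toReal_nonneg
    rw [abs_le]; constructor <;> linarith
  have hind : ProbabilityTheory.Indep (⨆ i : ℕ, (Fp (-(i : ℝ)) ⊓ Fm (i : ℝ)))
      (MeasurableSpace.comap X inferInstance) P := by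
    apply ProbabilityTheory.indep_iSup_of_directed_le
    · intro i
      rw [ProbabilityTheory.Indep_iff]
      rintro E _ hE ⟨B, hB, rfl⟩
      have hEm : MeasurableSet[Fm (i : ℝ)] E := hE.2
      by_cases h0 : P E = 0
      · rw [h0, zero_mul]
        exact measure_mono_null Set.inter_subset_left h0
      have hpos : 0 < P E := pos_iff_ne_zero.mpr h0
      have hle : ∀ s : ℝ,
          |(P (X ⁻¹' B ∩ E)).toReal / (P E).toReal - (P (X ⁻¹' B)).toReal| ≤ φ s := by
        intro s
        obtain ⟨Y, hY, hYX⟩ := key (i + s)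
        have e1 : (Y ⁻¹' B : Set Ω) =ᵐ[P] (X ⁻¹' B : Set Ω) := by
          filter_upwards [hYX] with ω hω
          apply propext
          change Y ω ∈ B ↔ X ω ∈ B
          rw [hω]
        have := hbound i s E (Y ⁻¹' B) hEm (hY hB) hpos
        rwa [measure_congr e1, measure_congr (e1.inter (ae_eq_refl E))] at this
      have hz := le_antisymm (ge_of_tendsto' hmix hle) (abs_nonneg _)
      have hEr : (P E).toReal ≠ 0 := (ENNReal.toReal_pos h0 (measure_ne_top _ _)).ne'
      have hz' := (div_eq_iff hEr).mp (sub_eq_zero.mp (abs_eq_zero.mp hz))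
      rw [← ENNReal.toReal_mul] at hz'
      rw [Set.inter_comm, mul_comm]
      exact (ENNReal.toReal_eq_toReal_iff' (measure_ne_top _ _)
        (ENNReal.mul_ne_top (measure_ne_top _ _) (measure_ne_top _ _))).mp hz'
    · exact fun i => inf_le_left.trans (hFp_le _)
    · exact hXm.comap_le
    · apply Monotone.directed_le
      intro i j hij
      have : (i : ℝ) ≤ j := by exact_mod_cast hij
      exact inf_le_inf (hFp_anti (by linarith)) (hFm_mono this)
  have hXX : ProbabilityTheory.IndepFun X X P := by
    rw [ProbabilityTheory.IndepFun_iff_Indep]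
    exact ProbabilityTheory.indep_of_indep_of_le_left hind hXmeas.comap_le
  have hL : MemLp X 2 P := MemLp.of_bound hXm.aestronglyMeasurable 1
    (ae_of_all _ fun ω => by rw [Real.norm_eq_abs, abs_of_nonneg (hX0 ω)]; exact hX1 ω)
  have hcov := hXX.covariance_eq_zero hL hL
  rw [ProbabilityTheory.covariance_self hXm.aemeasurable] at hcov
  have hev : ProbabilityTheory.evariance X P = 0 := by
    rw [← hL.ofReal_variance_eq, hcov, ENNReal.ofReal_zero]
  exact (ProbabilityTheory.evariance_eq_zero_iff hXm.aemeasurable).mp hev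
end

section
/- (Convexity of the Wulff shape via the angle bisector inequality.) Let d ≥ 1, M ≥ 1, and let w : S^{d-1} → [M^{-1}, M] be a continuous function such that for all unit vectors e_1, e_2 ∈ S^{d-1} with e_2 ≠ −e_1, setting e' := (e_1+e_2)/|e_1+e_2|, one has w(e') ≥ w(e_1)w(e_2)|e_1+e_2|/(w(e_1)+w(e_2)). Then the set S := { s e : e ∈ S^{d-1}, s ∈ [0, w(e)) } ⊆ ℝ^d is convex. -/
theorem closed_between (K : Set ℝ) (hK : IsClosed K) (h0 : (0:ℝ) ∈ K) (h1 : (1:ℝ) ∈ K)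
    (hb : ∀ a ∈ K, ∀ b ∈ K, a < b → ∃ c ∈ K, a < c ∧ c < b) (t : ℝ) (ht0 : 0 ≤ t) (ht1 : t ≤ 1) :
    t ∈ K := by
  by_contra ht
  have hA : IsCompact (K ∩ Set.Icc 0 t) := isCompact_Icc.inter_left hK
  have hB : IsCompact (K ∩ Set.Icc t 1) := isCompact_Icc.inter_left hK
  obtain ⟨a, ⟨haK, ha0, hat⟩, ha⟩ := hA.exists_isGreatest ⟨0, h0, le_rfl, ht0⟩
  obtain ⟨b, ⟨hbK, hbt, hb1⟩, hb'⟩ := hB.exists_isLeast ⟨1, h1, ht1, le_rfl⟩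
  have hat' : a < t := lt_of_le_of_ne hat (fun h => ht (h ▸ haK))
  have hbt' : t < b := lt_of_le_of_ne hbt (fun h => ht (h ▸ hbK))
  obtain ⟨c, hc, hac, hcb⟩ := hb a haK b hbK (hat'.trans hbt')
  rcases le_total c t with h | h
  · exact absurd (ha ⟨hc, by linarith, h⟩) (not_le.2 hac)
  · exact absurd (hb' ⟨hc, h, by linarith⟩) (not_le.2 hcb)

theorem convexOn_of_weak {E : Type*} [NormedAddCommGroup E] [NormedSpace ℝ E] (g : E → ℝ)
    (hg : Continuous g)
    (h : ∀ x y, ∃ c : ℝ, 0 < c ∧ c < 1 ∧ g ((1 - c) • x + c • y) ≤ (1 - c) * g x + c * g y) :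
    ConvexOn ℝ Set.univ g := by
  refine ⟨convex_univ, fun x _ y _ α β hα hβ hαβ => ?_⟩
  obtain rfl : α = 1 - β := by linarith
  have := closed_between {t | g ((1 - t) • x + t • y) ≤ (1 - t) * g x + t * g y}
    (isClosed_le (by fun_prop) (by fun_prop)) (by simp) (by simp) ?_ β hβ (by linarith)
  · simpa using this
  intro a ha b hb hab
  simp only [Set.mem_setOf_eq] at ha hb ⊢
  obtain ⟨c, hc0, hc1, hc⟩ := h ((1 - a) • x + a • y) ((1 - b) • x + b • y)
  refine ⟨(1 - c) * a + c * b, ?_, by nlinarith, by nlinarith⟩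
  have e : (1 - c) • ((1 - a) • x + a • y) + c • ((1 - b) • x + b • y)
      = (1 - ((1 - c) * a + c * b)) • x + ((1 - c) * a + c * b) • y := by module
  rw [e] at hc
  have h1 := mul_le_mul_of_nonneg_left ha (sub_nonneg.2 hc1.le)
  have h2 := mul_le_mul_of_nonneg_left hb hc0.le
  linarith

/-- **Convexity of the Wulff shape via the angle bisector inequality.**
If the radial function `w : S^{d-1} → [M⁻¹, M]` is continuous and satisfies the angle bisector
inequality `w(e') ≥ w(e₁)w(e₂)|e₁+e₂|/(w(e₁)+w(e₂))` for `e' = (e₁+e₂)/|e₁+e₂|`, then the star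
shaped set `S = { s e : e ∈ S^{d-1}, 0 ≤ s < w(e) }` is convex. -/
theorem wulff_shape_convex
    {d : ℕ} (hd : 1 ≤ d) (M : ℝ) (hM : 1 ≤ M)
    (w : EuclideanSpace ℝ (Fin d) → ℝ)
    (hw_cont : ContinuousOn w (Metric.sphere 0 1))
    (hw_range : ∀ e : EuclideanSpace ℝ (Fin d), ‖e‖ = 1 → w e ∈ Set.Icc M⁻¹ M)
    (hbisect : ∀ e₁ e₂ : EuclideanSpace ℝ (Fin d), ‖e₁‖ = 1 → ‖e₂‖ = 1 → e₂ ≠ -e₁ →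
      w (‖e₁ + e₂‖⁻¹ • (e₁ + e₂)) ≥ w e₁ * w e₂ * ‖e₁ + e₂‖ / (w e₁ + w e₂))
    (S : Set (EuclideanSpace ℝ (Fin d)))
    (hS : S = {x | ∃ e : EuclideanSpace ℝ (Fin d), ∃ s : ℝ,
      ‖e‖ = 1 ∧ 0 ≤ s ∧ s < w e ∧ x = s • e}) :
    Convex ℝ S := by
  have hM0 : 0 < M := by linarith
  have wpos : ∀ e : EuclideanSpace ℝ (Fin d), ‖e‖ = 1 → 0 < w e := fun e he =>
    lt_of_lt_of_le (inv_pos.2 hM0) (hw_range e he).1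
  have nrm : ∀ x : EuclideanSpace ℝ (Fin d), x ≠ 0 → ‖‖x‖⁻¹ • x‖ = 1 := fun x hx => by
    rw [norm_smul, norm_inv, norm_norm, inv_mul_cancel₀ (norm_ne_zero_iff.2 hx)]
  obtain ⟨g, hg⟩ : ∃ g : EuclideanSpace ℝ (Fin d) → ℝ, ∀ x, g x = ‖x‖ / w (‖x‖⁻¹ • x) :=
    ⟨_, fun _ => rfl⟩
  have g0 : g 0 = 0 := by simp [hg]
  have gunit : ∀ e, ‖e‖ = 1 → g e = 1 / w e := fun e he => by simp [hg, he]
  have ghom : ∀ r : ℝ, 0 < r → ∀ x, g (r • x) = r * g x := by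
    intro r hr x
    have : ‖r • x‖⁻¹ • r • x = ‖x‖⁻¹ • x := by
      rw [norm_smul, Real.norm_of_nonneg hr.le, smul_smul, mul_inv, mul_right_comm,
        inv_mul_cancel₀ hr.ne', one_mul]
    rw [hg, hg, this, norm_smul, Real.norm_of_nonneg hr.le, mul_div_assoc]
  have gnn : ∀ x, 0 ≤ g x := by
    intro x
    by_cases hx : x = 0
    · rw [hx, g0]
    · rw [hg]; exact div_nonneg (norm_nonneg _) (wpos _ (nrm x hx)).le
  have gle : ∀ x, g x ≤ M * ‖x‖ := by
    intro x
    by_cases hx : x = 0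
    · simp [hx, g0]
    · rw [hg, div_le_iff₀ (wpos _ (nrm x hx))]
      have := (hw_range _ (nrm x hx)).1
      have h2 : 1 ≤ M * w (‖x‖⁻¹ • x) := by
        have := mul_le_mul_of_nonneg_left this hM0.le
        rwa [mul_inv_cancel₀ hM0.ne'] at this
      nlinarith [norm_nonneg x]
  have gcont : Continuous g := by
    rw [continuous_iff_continuousAt]
    intro x
    by_cases hx : x = 0
    · subst hx
      rw [ContinuousAt, g0]
      refine squeeze_zero gnn gle ?_
      have : Continuous fun x : EuclideanSpace ℝ (Fin d) => M * ‖x‖ := by fun_prop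
      simpa using this.tendsto 0
    · have hev : ∀ᶠ y in nhds x, y ≠ 0 := isOpen_ne.mem_nhds hx
      have hn : ContinuousAt (fun y : EuclideanSpace ℝ (Fin d) => ‖y‖⁻¹ • y) x :=
        (continuousAt_id.norm.inv₀ (norm_ne_zero_iff.2 hx)).smul continuousAt_id
      have hwc : ContinuousAt (fun y => w (‖y‖⁻¹ • y)) x := by
        have h1 := hw_cont (‖x‖⁻¹ • x) (by simpa using nrm x hx)
        refine Filter.Tendsto.comp h1 (tendsto_nhdsWithin_iff.2 ⟨hn, ?_⟩)
        filter_upwards [hev] with y hy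
        simpa using nrm y hy
      have hgf : g = fun y => ‖y‖ / w (‖y‖⁻¹ • y) := funext hg
      rw [hgf]
      exact continuousAt_id.norm.div hwc (wpos _ (nrm x hx)).ne'
  have gadd1 : ∀ e₁ e₂, ‖e₁‖ = 1 → ‖e₂‖ = 1 → g (e₁ + e₂) ≤ g e₁ + g e₂ := by
    intro e₁ e₂ h1 h2
    by_cases h : e₂ = -e₁
    · subst h
      rw [add_neg_cancel, g0]
      exact add_nonneg (gnn _) (gnn _)
    · have hne : e₁ + e₂ ≠ 0 := fun h' => h (eq_neg_of_add_eq_zero_right h')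
      have hb := hbisect e₁ e₂ h1 h2 h
      have p1 := wpos _ h1
      have p2 := wpos _ h2
      rw [gunit _ h1, gunit _ h2, hg, div_le_iff₀ (wpos _ (nrm _ hne))]
      have hs : 0 < 1 / w e₁ + 1 / w e₂ := by positivity
      refine le_trans (le_of_eq ?_) (mul_le_mul_of_nonneg_left hb hs.le)
      field_simp
      try ring
  have gadd : ∀ r : ℝ, 0 < r → ∀ p q, ‖p‖ = r → ‖q‖ = r → g (p + q) ≤ g p + g q := by
    intro r hr p q hp hq
    have key : ∀ p : EuclideanSpace ℝ (Fin d), p = r • r⁻¹ • p := fun p => by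
      rw [smul_smul, mul_inv_cancel₀ hr.ne', one_smul]
    have hk := gadd1 (r⁻¹ • p) (r⁻¹ • q)
      (by rw [norm_smul, hp, Real.norm_of_nonneg (by positivity), inv_mul_cancel₀ hr.ne'])
      (by rw [norm_smul, hq, Real.norm_of_nonneg (by positivity), inv_mul_cancel₀ hr.ne'])
    rw [← smul_add, ghom _ (inv_pos.2 hr), ghom _ (inv_pos.2 hr), ghom _ (inv_pos.2 hr),
      ← mul_add] at hk
    exact le_of_mul_le_mul_left hk (inv_pos.2 hr)
  have gconv : ConvexOn ℝ Set.univ g := by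
    refine convexOn_of_weak g gcont fun x y => ?_
    by_cases hx : x = 0
    · refine ⟨1 / 2, by norm_num, by norm_num, ?_⟩
      rw [hx, smul_zero, zero_add, g0, ghom _ (by norm_num)]
      simp
    by_cases hy : y = 0
    · refine ⟨1 / 2, by norm_num, by norm_num, ?_⟩
      rw [hy, smul_zero, add_zero, g0, ghom _ (by norm_num)]
      simp
    have px := norm_pos_iff.2 hx
    have py := norm_pos_iff.2 hy
    have hc0 : 0 < ‖x‖ / (‖x‖ + ‖y‖) := by positivity
    have hc : 1 - ‖x‖ / (‖x‖ + ‖y‖) = ‖y‖ / (‖x‖ + ‖y‖) := by field_simp; ring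
    have hc1 : 0 < ‖y‖ / (‖x‖ + ‖y‖) := by positivity
    refine ⟨‖x‖ / (‖x‖ + ‖y‖), hc0, by linarith, ?_⟩
    rw [hc, ← ghom _ hc1, ← ghom _ hc0]
    refine gadd (‖x‖ * ‖y‖ / (‖x‖ + ‖y‖)) (by positivity) _ _ ?_ ?_
    · rw [norm_smul, Real.norm_of_nonneg hc1.le]; ring
    · rw [norm_smul, Real.norm_of_nonneg hc0.le]; ring
  have hSg : S = {x ∈ Set.univ | g x < 1} := by
    rw [hS]
    ext x
    simp only [Set.mem_setOf_eq, Set.mem_univ, true_and]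
    constructor
    · rintro ⟨e, s, he, hs0, hs, rfl⟩
      rcases hs0.eq_or_lt with h | h
      · rw [← h, zero_smul, g0]; norm_num
      · rw [ghom _ h, gunit _ he, mul_one_div, div_lt_one (wpos _ he)]; exact hs
    · intro hx
      by_cases h : x = 0
      · have he : ‖(EuclideanSpace.single (⟨0, hd⟩ : Fin d) (1 : ℝ))‖ = 1 := by simp
        exact ⟨_, 0, he, le_rfl, wpos _ he, by simp [h]⟩
      · refine ⟨‖x‖⁻¹ • x, ‖x‖, nrm x h, norm_nonneg _, ?_, ?_⟩
        · rwa [hg, div_lt_one (wpos _ (nrm x h))] at hx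
        · rw [smul_smul, mul_inv_cancel₀ (norm_ne_zero_iff.2 h), one_smul]
  rw [hSg]
  exact gconv.convex_lt 1
end

section
/- (Time-shift monotonicity of reachable sets.) Let c : ℝ×ℝ^d → [0,∞) and v : ℝ×ℝ^d → ℝ^d be measurable, and suppose there is M ≥ 1 such that B_{t/M}(x) ⊆ Γ(t; t_1, x) for every (t_1, x) ∈ ℝ^{d+1} and every t ≥ M. Then for any (t_0, x_0, z) with s ≥ M(|z − x_0| + 1) and any t ≥ 0, one has Γ(t; t_0+s, z) ⊆ Γ(t+s; t_0, x_0). -/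
open MeasureTheory Filter Metric

noncomputable section

/-- `ℝ^d` with the Euclidean norm. -/
abbrev Euc (d : ℕ) : Type := EuclideanSpace ℝ (Fin d)

/-- `(t₁, x₁)` is reachable from `(t₀, x₀)`: there is an absolutely continuous path
`γ : [t₀,t₁] → ℝ^d` (given by the integral of its a.e. derivative `g`) with `γ(t₀) = x₀`,
`γ(t₁) = x₁`, and `|γ'(t) − v(t,γ(t))| ≤ c(t,γ(t))` for a.e. `t ∈ [t₀,t₁]`. -/
def Reachable {d : ℕ} (c : ℝ → Euc d → ℝ) (v : ℝ → Euc d → Euc d)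
    (t0 : ℝ) (x0 : Euc d) (t1 : ℝ) (x1 : Euc d) : Prop :=
  t0 ≤ t1 ∧ ∃ γ g : ℝ → Euc d,
    IntervalIntegrable g volume t0 t1 ∧
    (∀ t ∈ Set.Icc t0 t1, γ t = x0 + ∫ s in t0..t, g s) ∧
    γ t1 = x1 ∧
    ∀ᵐ s ∂(volume.restrict (Set.Icc t0 t1)), ‖g s - v s (γ s)‖ ≤ c s (γ s)

/-- The reachable set `Γ(t; t₀, x₀)`. -/
def reachSet {d : ℕ} (c : ℝ → Euc d → ℝ) (v : ℝ → Euc d → Euc d)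
    (t t0 : ℝ) (x0 : Euc d) : Set (Euc d) :=
  {x | Reachable c v t0 x0 (t0 + t) x}

theorem Reachable.trans_aux {d : ℕ} {c : ℝ → Euc d → ℝ} {v : ℝ → Euc d → Euc d}
    {a b e : ℝ} {x y z : Euc d} (h1 : Reachable c v a x b y) (h2 : Reachable c v b y e z) :
    Reachable c v a x e z := by
  obtain ⟨hab, γ1, g1, hi1, hγ1, he1, ha1⟩ := h1
  obtain ⟨hbe, γ2, g2, hi2, hγ2, he2, ha2⟩ := h2
  set g : ℝ → Euc d := fun t => if t ≤ b then g1 t else g2 t with hg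
  set γ : ℝ → Euc d := fun t => if t ≤ b then γ1 t else γ2 t with hγ
  have eq1 : ∀ t, a ≤ t → t ≤ b → Set.EqOn g1 g (Set.uIoc a t) := by
    intro t hat ht r hr
    rw [Set.uIoc_of_le hat] at hr
    simp [hg, hr.2.trans ht]
  have eq2 : ∀ t, b ≤ t → Set.EqOn g2 g (Set.uIoc b t) := by
    intro t hbt r hr
    rw [Set.uIoc_of_le hbt] at hr
    simp [hg, not_le.mpr hr.1]
  have int1 : ∀ t, a ≤ t → t ≤ b → ∫ s in a..t, g s = ∫ s in a..t, g1 s := by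
    intro t hat ht
    exact (intervalIntegral.integral_congr_ae (Eventually.of_forall fun r hr => eq1 t hat ht hr)).symm
  have int2 : ∀ t, b ≤ t → ∫ s in b..t, g s = ∫ s in b..t, g2 s := by
    intro t hbt
    exact (intervalIntegral.integral_congr_ae (Eventually.of_forall fun r hr => eq2 t hbt hr)).symm
  have I1 : IntervalIntegrable g volume a b := hi1.congr (eq1 b hab le_rfl)
  have I2 : IntervalIntegrable g volume b e := hi2.congr (eq2 e hbe)
  have hy : x + ∫ s in a..b, g1 s = y := by
    rw [← hγ1 b ⟨hab, le_rfl⟩, he1]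
  refine ⟨hab.trans hbe, γ, g, I1.trans I2, ?_, ?_, ?_⟩
  · intro t ht
    by_cases htb : t ≤ b
    · rw [int1 t ht.1 htb, ← hγ1 t ⟨ht.1, htb⟩]
      simp [hγ, htb]
    · have hbt : b ≤ t := (not_le.mp htb).le
      have I3 : IntervalIntegrable g volume b t := I2.mono_set (by
        rw [Set.uIcc_of_le hbt, Set.uIcc_of_le hbe]
        exact Set.Icc_subset_Icc le_rfl ht.2)
      rw [← intervalIntegral.integral_add_adjacent_intervals I1 I3, int1 b hab le_rfl,
        int2 t hbt, ← add_assoc, hy, ← hγ2 t ⟨hbt, ht.2⟩]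
      simp [hγ, htb]
  · by_cases heb : e ≤ b
    · have : e = b := le_antisymm heb hbe
      subst this
      have h := hγ2 e ⟨le_rfl, le_rfl⟩
      simp only [intervalIntegral.integral_same, add_zero] at h
      simp only [hγ, le_refl, if_true]
      rw [he1, ← h, he2]
    · simp [hγ, heb, he2]
  · rw [ae_restrict_iff' measurableSet_Icc] at ha1 ha2 ⊢
    filter_upwards [ha1, ha2] with r h1 h2 hr
    by_cases hrb : r ≤ b
    · simpa [hg, hγ, hrb] using h1 ⟨hr.1, hrb⟩
    · simpa [hg, hγ, hrb] using h2 ⟨(not_le.mp hrb).le, hr.2⟩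

/-- **Time-shift monotonicity of reachable sets.**  If every point expands at least at speed
`1/M` after time `M`, then `Γ(t; t₀+s, z) ⊆ Γ(t+s; t₀, x₀)` whenever `s ≥ M(|z − x₀| + 1)`. -/
theorem reachSet_time_shift
    {d : ℕ} (c : ℝ → Euc d → ℝ) (v : ℝ → Euc d → Euc d)
    (hc0 : ∀ t x, 0 ≤ c t x)
    (hcmeas : Measurable (Function.uncurry c)) (hvmeas : Measurable (Function.uncurry v))
    (M : ℝ) (hM : 1 ≤ M)
    (hgrow : ∀ t1 : ℝ, ∀ x : Euc d, ∀ t : ℝ, M ≤ t →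
      Metric.ball x (t / M) ⊆ reachSet c v t t1 x)
    (t0 : ℝ) (x0 z : Euc d) (s : ℝ) (hs : M * (‖z - x0‖ + 1) ≤ s)
    (t : ℝ) (ht : 0 ≤ t) :
    reachSet c v t (t0 + s) z ⊆ reachSet c v (t + s) t0 x0 := by
  intro w hw
  have hM0 : 0 < M := by linarith
  have hz : z ∈ reachSet c v s t0 x0 := by
    apply hgrow t0 x0 s
    · nlinarith [norm_nonneg (z - x0)]
    · rw [Metric.mem_ball, dist_eq_norm, lt_div_iff₀ hM0]
      nlinarith
  have h : Reachable c v t0 x0 (t0 + s + t) w := Reachable.trans_aux hz hw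
  have e : t0 + (t + s) = t0 + s + t := by ring
  change Reachable c v t0 x0 (t0 + (t + s)) w
  rw [e]
  exact h
end
end

section
/- (Uniform continuity of the control representation formula.) Let c : ℝ×ℝ^d → [0,∞) and v : ℝ×ℝ^d → ℝ^d be bounded, uniformly continuous in t (uniformly in x), and uniformly Lipschitz in x. Let u_0 : ℝ^d → ℝ be uniformly continuous, and define u(t,x) := sup{ u_0(y) : x ∈ Γ(t; 0, y) } for (t,x) ∈ [0,∞)×ℝ^d. Then u is real-valued and, for every T > 0, u is uniformly continuous on [0,T]×ℝ^d. -/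
open MeasureTheory Filter Metric

noncomputable section

lemma aux_exp_int (lam s T : ℝ) (hl : 0 < lam) :
    ∫ τ in s..T, Real.exp (lam * (T - τ)) = (Real.exp (lam * (T - s)) - 1) / lam := by
  have h : ∀ τ ∈ Set.uIcc s T, HasDerivAt (fun τ => -(Real.exp (lam * (T - τ)) / lam))
      (Real.exp (lam * (T - τ))) τ := by
    intro τ _
    have h1 : HasDerivAt (fun τ : ℝ => lam * (T - τ)) (lam * (-1)) τ :=
      ((hasDerivAt_id τ).const_sub T).const_mul lam
    have h2 := (h1.exp.div_const lam).neg
    have h3 : -(Real.exp (lam * (T - τ)) * (lam * -1) / lam) = Real.exp (lam * (T - τ)) := by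
      field_simp
    rw [h3] at h2
    exact h2
  rw [intervalIntegral.integral_eq_sub_of_hasDerivAt h
    (Continuous.intervalIntegrable (by fun_prop) _ _)]
  simp
  ring

lemma aux_gronwall (f : ℝ → ℝ) (hf : Continuous f) (A Λ m : ℝ) (hΛ : 0 < Λ)
    (hm : 0 ≤ m)
    (h : ∀ s ∈ Set.Icc 0 m, f s ≤ A + Λ * ∫ τ in s..m, f τ) (hf0 : ∀ s, 0 ≤ f s) (hA : 0 ≤ A) :
    f 0 ≤ 2 * A * Real.exp (2 * Λ * m) := by
  obtain ⟨p, hp, hmax⟩ := (isCompact_Icc (a := (0:ℝ)) (b := m)).exists_isMaxOn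
    ⟨0, by simp [hm]⟩ (f := fun s => Real.exp (-(2 * Λ * (m - s))) * f s)
    (Continuous.continuousOn (by fun_prop))
  set M := Real.exp (-(2 * Λ * (m - p))) * f p with hM
  have hle : ∀ s ∈ Set.Icc 0 m, f s ≤ M * Real.exp (2 * Λ * (m - s)) := by
    intro s hs
    have := hmax hs
    simp only [Set.mem_ofPred_eq] at this
    calc f s = (Real.exp (-(2 * Λ * (m - s))) * f s) * Real.exp (2 * Λ * (m - s)) := by
          rw [mul_right_comm, ← Real.exp_add]; simp
      _ ≤ _ := by gcongr
  have hM0 : 0 ≤ M := mul_nonneg (Real.exp_pos _).le (hf0 _)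
  have h1 := h p hp
  have h2 : ∫ τ in p..m, f τ ≤ ∫ τ in p..m, M * Real.exp (2 * Λ * (m - τ)) := by
    apply intervalIntegral.integral_mono_on hp.2 (hf.intervalIntegrable _ _)
      (Continuous.intervalIntegrable (by fun_prop) _ _)
    intro τ hτ
    exact hle τ ⟨hp.1.trans hτ.1, hτ.2⟩
  rw [intervalIntegral.integral_const_mul, aux_exp_int _ _ _ (by positivity)] at h2
  have h3 : M ≤ A + M / 2 := by
    have e1 : Real.exp (-(2 * Λ * (m - p))) * Real.exp (2 * Λ * (m - p)) = 1 := by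
      rw [← Real.exp_add]; simp
    have e2 : Real.exp (-(2 * Λ * (m - p))) ≤ 1 := by
      apply Real.exp_le_one_iff.2
      have : 0 ≤ 2 * Λ * (m - p) := mul_nonneg (by positivity) (by linarith [hp.2])
      linarith
    have e3 := Real.exp_pos (-(2 * Λ * (m - p)))
    have h4 : f p ≤ A + M / 2 * Real.exp (2 * Λ * (m - p)) := by
      calc f p ≤ A + Λ * (M * ((Real.exp (2 * Λ * (m - p)) - 1) / (2 * Λ))) :=
            h1.trans (by gcongr)
        _ = A + M / 2 * (Real.exp (2 * Λ * (m - p)) - 1) := by field_simp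
        _ ≤ _ := by gcongr; linarith
    calc M ≤ Real.exp (-(2 * Λ * (m - p))) * (A + M / 2 * Real.exp (2 * Λ * (m - p))) := by
          rw [hM]; gcongr
      _ = Real.exp (-(2 * Λ * (m - p))) * A + M / 2 * (Real.exp (-(2 * Λ * (m - p))) * Real.exp (2 * Λ * (m - p))) := by ring
      _ ≤ _ := by rw [e1]; nlinarith
  have := hle 0 ⟨le_rfl, hm⟩
  rw [sub_zero] at this
  refine this.trans ?_
  gcongr
  linarith

/-- data of a regular pair. -/
structure RegPair {d : ℕ} (c : ℝ → Euc d → ℝ) (v : ℝ → Euc d → Euc d) (K L : ℝ) : Prop where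
  c0 : ∀ t x, 0 ≤ c t x
  cK : ∀ t x, c t x ≤ K
  vK : ∀ t x, ‖v t x‖ ≤ K
  L0 : 0 < L
  cL : ∀ t x x', |c t x - c t x'| ≤ L * ‖x - x'‖
  vL : ∀ t x x', ‖v t x - v t x'‖ ≤ L * ‖x - x'‖
  cc : Continuous (fun p : ℝ × Euc d => c p.1 p.2)
  vc : Continuous (fun p : ℝ × Euc d => v p.1 p.2)

def FF {d : ℕ} (c : ℝ → Euc d → ℝ) (v : ℝ → Euc d → Euc d) (a : ℝ → Euc d) (ξ : ℝ → Euc d)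
    (s : ℝ) : Euc d := v s (ξ s) + c s (ξ s) • a s

def Traj {d : ℕ} (c : ℝ → Euc d → ℝ) (v : ℝ → Euc d → Euc d) (a : ℝ → Euc d)
    (t : ℝ) (x : Euc d) (ξ : ℝ → Euc d) : Prop :=
  Continuous ξ ∧ ∀ s ∈ Set.Icc 0 t, ξ s = x + ∫ τ in t..s, FF c v a ξ τ

section

variable {d : ℕ} {c : ℝ → Euc d → ℝ} {v : ℝ → Euc d → Euc d} {K L : ℝ}

lemma RegPair.FF_bound (h : RegPair c v K L) {a : ℝ → Euc d} (ha : ∀ s, ‖a s‖ ≤ 1)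
    (ξ : ℝ → Euc d) (s : ℝ) : ‖FF c v a ξ s‖ ≤ 2 * K := by
  unfold FF
  refine (norm_add_le _ _).trans ?_
  rw [norm_smul, Real.norm_of_nonneg (h.c0 _ _)]
  have := mul_le_mul (h.cK s (ξ s)) (ha s) (norm_nonneg _) ((h.c0 s (ξ s)).trans (h.cK _ _))
  linarith [h.vK s (ξ s)]

lemma RegPair.FF_lip (h : RegPair c v K L) {a : ℝ → Euc d} (ha : ∀ s, ‖a s‖ ≤ 1)
    (ξ ξ' : ℝ → Euc d) (s : ℝ) : ‖FF c v a ξ s - FF c v a ξ' s‖ ≤ 2 * L * ‖ξ s - ξ' s‖ := by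
  have : FF c v a ξ s - FF c v a ξ' s = (v s (ξ s) - v s (ξ' s)) + (c s (ξ s) - c s (ξ' s)) • a s := by
    unfold FF; rw [sub_smul]; abel
  rw [this]
  refine (norm_add_le _ _).trans ?_
  rw [norm_smul, Real.norm_eq_abs]
  have := mul_le_mul (h.cL s (ξ s) (ξ' s)) (ha s) (norm_nonneg _)
    (mul_nonneg h.L0.le (norm_nonneg _))
  linarith [h.vL s (ξ s) (ξ' s)]

lemma RegPair.FF_int (h : RegPair c v K L) {a : ℝ → Euc d} (ha : ∀ s, ‖a s‖ ≤ 1)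
    (ham : AEStronglyMeasurable a volume) {ξ : ℝ → Euc d} (hξ : Continuous ξ) (s t : ℝ) :
    IntervalIntegrable (FF c v a ξ) volume s t := by
  have hv : Continuous (fun s => v s (ξ s)) := h.vc.comp (continuous_id.prodMk hξ)
  have hc : Continuous (fun s => c s (ξ s)) := h.cc.comp (continuous_id.prodMk hξ)
  have hm : AEStronglyMeasurable (FF c v a ξ) volume :=
    hv.aestronglyMeasurable.add (hc.aestronglyMeasurable.smul ham)
  refine (intervalIntegrable_const (c := 2 * K)).mono_fun hm.restrict ?_
  exact Eventually.of_forall fun s => (h.FF_bound ha ξ s).trans (le_abs_self _)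

lemma RegPair.exists_traj (h : RegPair c v K L) {a : ℝ → Euc d} (ha : ∀ s, ‖a s‖ ≤ 1)
    (ham : AEStronglyMeasurable a volume) {T : ℝ} (hT : 0 ≤ T) (x : Euc d) :
    ∃ ξ, Traj c v a T x ξ := by
  have hL := h.L0
  let ext : C(Set.Icc 0 T, Euc d) → ℝ → Euc d := fun w τ =>
    Real.exp (4 * L * (T - τ)) • Set.IccExtend hT w τ
  have hext : ∀ w, Continuous (ext w) := fun w => by
    have : Continuous (Set.IccExtend hT w) := w.continuous.Icc_extend'
    have h2 : Continuous (fun τ : ℝ => Real.exp (4 * L * (T - τ))) := by fun_prop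
    exact h2.smul this
  let Φ : C(Set.Icc 0 T, Euc d) → C(Set.Icc 0 T, Euc d) := fun w =>
    ⟨fun s => Real.exp (-(4 * L * (T - s))) • (x + ∫ τ in T..s, FF c v a (ext w) τ), by
      have : Continuous (fun s => ∫ τ in T..s, FF c v a (ext w) τ) :=
        intervalIntegral.continuous_primitive (fun p q => h.FF_int ha ham (hext w) p q) T
      have h2 := this.comp (continuous_subtype_val (p := fun s => s ∈ Set.Icc 0 T))
      have h3 : Continuous (fun s : Set.Icc 0 T => Real.exp (-(4 * L * (T - s)))) := by fun_prop
      exact h3.smul (continuous_const.add h2)⟩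
  have hΦ : ContractingWith (1/2) Φ := by
    refine ⟨by norm_num, LipschitzWith.of_dist_le_mul fun w w' => ?_⟩
    rw [ContinuousMap.dist_le (by positivity)]
    intro s
    have hs := s.2
    simp only [Φ, ContinuousMap.coe_mk]
    rw [dist_eq_norm, ← smul_sub, norm_smul, Real.norm_of_nonneg (Real.exp_pos _).le,
      add_sub_add_left_eq_sub, ← intervalIntegral.integral_sub (h.FF_int ha ham (hext w) _ _)
      (h.FF_int ha ham (hext w') _ _), intervalIntegral.integral_symm, norm_neg]
    have key : ‖∫ τ in (s:ℝ)..T, (FF c v a (ext w) τ - FF c v a (ext w') τ)‖ ≤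
        ∫ τ in (s:ℝ)..T, 2 * L * dist w w' * Real.exp (4 * L * (T - τ)) := by
      refine intervalIntegral.norm_integral_le_of_norm_le hs.2 (Eventually.of_forall fun τ _ => ?_)
        (Continuous.intervalIntegrable (by fun_prop) _ _)
      refine (h.FF_lip ha _ _ τ).trans ?_
      simp only [ext]
      rw [← smul_sub, norm_smul, Real.norm_of_nonneg (Real.exp_pos _).le, ← dist_eq_norm]
      have : dist (Set.IccExtend hT w τ) (Set.IccExtend hT w' τ) ≤ dist w w' :=
        ContinuousMap.dist_apply_le_dist _
      calc _ ≤ 2 * L * (Real.exp (4 * L * (T - τ)) * dist w w') := by gcongr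
        _ = _ := by ring
    rw [intervalIntegral.integral_const_mul, aux_exp_int _ _ _ (by positivity)] at key
    have e1 : Real.exp (-(4 * L * (T - s))) * Real.exp (4 * L * (T - s)) = 1 := by
      rw [← Real.exp_add]; simp
    calc _ ≤ Real.exp (-(4 * L * (T - s))) * (2 * L * dist w w' * ((Real.exp (4 * L * (T - s)) - 1) / (4 * L))) := by gcongr
      _ = (Real.exp (-(4 * L * (T - s))) * Real.exp (4 * L * (T - s)) - Real.exp (-(4 * L * (T - s)))) * (dist w w' / 2) := by field_simp; ring
      _ ≤ 1 * (dist w w' / 2) := by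
        rw [e1]; gcongr; linarith [Real.exp_pos (-(4 * L * (T - (s:ℝ))))]
      _ = _ := by push_cast; ring
  let w := ContractingWith.fixedPoint Φ hΦ
  have hw : Φ w = w := hΦ.fixedPoint_isFixedPt
  refine ⟨ext w, hext w, fun s hs => ?_⟩
  have h1 : (Φ w) ⟨s, hs⟩ = w ⟨s, hs⟩ := by rw [hw]
  simp only [Φ, ContinuousMap.coe_mk] at h1
  have : ext w s = Real.exp (4 * L * (T - s)) • w ⟨s, hs⟩ := by
    simp only [ext]; rw [Set.IccExtend_of_mem]
  rw [this, ← h1, smul_smul, ← Real.exp_add]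
  simp

lemma RegPair.traj_reach (h : RegPair c v K L) {a : ℝ → Euc d} (ha : ∀ s, ‖a s‖ ≤ 1)
    (ham : AEStronglyMeasurable a volume) {T : ℝ} (hT : 0 ≤ T) {x : Euc d} {ξ : ℝ → Euc d}
    (hξ : Traj c v a T x ξ) : Reachable c v 0 (ξ 0) T x := by
  have hi := h.FF_int ha ham hξ.1
  refine ⟨hT, ξ, FF c v a ξ, hi _ _, fun t ht => ?_, ?_, ?_⟩
  · rw [hξ.2 t ht, hξ.2 0 ⟨le_rfl, hT⟩, add_assoc,
      intervalIntegral.integral_add_adjacent_intervals (hi _ _) (hi _ _)]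
  · rw [hξ.2 T ⟨hT, le_rfl⟩]; simp
  · refine Eventually.of_forall fun s => ?_
    simp only [FF, add_sub_cancel_left]
    rw [norm_smul, Real.norm_of_nonneg (h.c0 _ _)]
    exact mul_le_of_le_one_right (h.c0 _ _) (ha s)

lemma RegPair.reach_traj (h : RegPair c v K L) {t : ℝ} {x y : Euc d}
    (hr : Reachable c v 0 y t x) : ∃ a : ℝ → Euc d, (∀ s, ‖a s‖ ≤ 1) ∧
      AEStronglyMeasurable a volume ∧ ∃ ξ, Traj c v a t x ξ ∧ ξ 0 = y := by
  obtain ⟨ht, γ, g, hg, hγ, hx, hae⟩ := hr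
  have hgI : IntegrableOn g (Set.Icc 0 t) volume :=
    (intervalIntegrable_iff_integrableOn_Icc_of_le ht).1 hg
  have hγc : ContinuousOn γ (Set.Icc 0 t) := by
    have := intervalIntegral.continuousOn_primitive_interval (f := g) (a := 0) (b := t) (μ := volume)
      (by rwa [Set.uIcc_of_le ht])
    rw [Set.uIcc_of_le ht] at this
    exact (continuousOn_const.add this).congr hγ
  let ξ : ℝ → Euc d := Set.IccExtend ht ((Set.Icc 0 t).domRestrict γ)
  have hξc : Continuous ξ := (continuousOn_iff_continuous_domRestrict.1 hγc).Icc_extend'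
  have hξ : ∀ s ∈ Set.Icc 0 t, ξ s = γ s := fun s hs => by
    simp only [ξ]; rw [Set.IccExtend_of_mem ht _ hs]; rfl
  have hv : Continuous (fun s => v s (ξ s)) := h.vc.comp (continuous_id.prodMk hξc)
  have hc : Continuous (fun s => c s (ξ s)) := h.cc.comp (continuous_id.prodMk hξc)
  let b : ℝ → Euc d := fun s => (max (c s (ξ s)) ‖g s - v s (ξ s)‖)⁻¹ • (g s - v s (ξ s))
  let a := (Set.Icc 0 t).indicator b
  have hb1 : ∀ s, ‖b s‖ ≤ 1 := by
    intro s
    simp only [b]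
    have h0 : 0 ≤ max (c s (ξ s)) ‖g s - v s (ξ s)‖ := le_max_of_le_right (norm_nonneg _)
    rw [norm_smul, norm_inv, Real.norm_of_nonneg h0]
    exact inv_mul_le_one_of_le₀ (le_max_right _ _) h0
  have ha1 : ∀ s, ‖a s‖ ≤ 1 := fun s => (norm_indicator_le_norm_self _ _).trans (hb1 s)
  have ham : AEStronglyMeasurable a volume := by
    rw [aestronglyMeasurable_indicator_iff measurableSet_Icc]
    have hd : AEStronglyMeasurable (fun s => g s - v s (ξ s)) (volume.restrict (Set.Icc 0 t)) :=
      hgI.aestronglyMeasurable.sub hv.aestronglyMeasurable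
    have := (hc.aestronglyMeasurable (μ := volume.restrict (Set.Icc 0 t))).aemeasurable.max hd.norm.aemeasurable
    exact this.inv.aestronglyMeasurable.smul hd
  have hFg : ∀ᵐ s ∂(volume.restrict (Set.Icc 0 t)), g s = FF c v a ξ s := by
    filter_upwards [hae, ae_restrict_mem measurableSet_Icc] with s hs hmem
    rw [← hξ s hmem] at hs
    simp only [FF, a, Set.indicator_of_mem hmem, b]
    rw [max_eq_left hs, smul_smul]
    rcases (h.c0 s (ξ s)).eq_or_lt with h0 | h0
    · rw [← h0] at hs
      have := norm_le_zero_iff.1 hs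
      rw [← h0]; simp; exact sub_eq_zero.1 this
    · rw [mul_inv_cancel₀ h0.ne']; simp
  have hint : ∀ s ∈ Set.Icc 0 t, ∫ τ in t..s, g τ = ∫ τ in t..s, FF c v a ξ τ := by
    intro s hs
    apply intervalIntegral.integral_congr_ae
    rw [ae_restrict_iff' measurableSet_Icc] at hFg
    filter_upwards [hFg] with τ hτ hm
    rw [Set.uIoc_of_ge hs.2] at hm
    exact hτ ⟨hs.1.trans hm.1.le, hm.2⟩
  refine ⟨a, ha1, ham, ξ, ⟨hξc, fun s hs => ?_⟩, ?_⟩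
  · rw [hξ s hs, ← hint s hs, hγ s hs, ← hx, hγ t ⟨ht, le_rfl⟩, add_assoc,
      intervalIntegral.integral_add_adjacent_intervals hg]
    refine hg.symm.mono_set ?_
    rw [Set.uIcc_of_ge hs.2, Set.uIcc_of_ge ht]
    exact Set.Icc_subset_Icc_left hs.1
  · rw [hξ 0 ⟨le_rfl, ht⟩, hγ 0 ⟨le_rfl, ht⟩]; simp

lemma RegPair.traj_dist (h : RegPair c v K L) {a : ℝ → Euc d} (ha : ∀ s, ‖a s‖ ≤ 1)
    {t : ℝ} {x : Euc d} {ξ : ℝ → Euc d} (hξ : Traj c v a t x ξ) {s : ℝ} (hs : s ∈ Set.Icc 0 t) :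
    ‖ξ s - x‖ ≤ 2 * K * (t - s) := by
  rw [hξ.2 s hs, add_sub_cancel_left]
  refine (intervalIntegral.norm_integral_le_of_norm_le_const
    fun τ _ => h.FF_bound ha ξ τ).trans ?_
  rw [abs_sub_comm, abs_of_nonneg (by linarith [hs.2])]

lemma RegPair.compare (h : RegPair c v K L) {a : ℝ → Euc d} (ha : ∀ s, ‖a s‖ ≤ 1)
    (ham : AEStronglyMeasurable a volume) {t t' : ℝ} (ht : 0 ≤ t) (ht' : 0 ≤ t') {x x' : Euc d}
    {ξ ξ' : ℝ → Euc d} (hξ : Traj c v a t x ξ) (hξ' : Traj c v a t' x' ξ') :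
    ‖ξ 0 - ξ' 0‖ ≤ 2 * (‖x - x'‖ + 2 * K * |t - t'|) * Real.exp (4 * L * t) := by
  have hL := h.L0
  have hK : 0 ≤ K := (norm_nonneg _).trans (h.vK 0 0)
  set m := min t t' with hm
  have hm0 : 0 ≤ m := le_min ht ht'
  have hmt : m ≤ t := min_le_left _ _
  have hmt' : m ≤ t' := min_le_right _ _
  have hadd : (t - m) + (t' - m) = |t - t'| := by
    rcases le_total t t' with q | q
    · rw [hm, min_eq_left q, abs_sub_comm, abs_of_nonneg (by linarith)]; ring
    · rw [hm, min_eq_right q, abs_of_nonneg (by linarith)]; ring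
  have d1 := h.traj_dist ha hξ (s := m) ⟨hm0, hmt⟩
  have d2 := h.traj_dist ha hξ' (s := m) ⟨hm0, hmt'⟩
  have hA : ‖ξ m - ξ' m‖ ≤ ‖x - x'‖ + 2 * K * |t - t'| := by
    have e : ξ m - ξ' m = (ξ m - x) + (x - x') - (ξ' m - x') := by abel
    rw [e, ← hadd]
    refine (norm_sub_le _ _).trans ?_
    have := norm_add_le (ξ m - x) (x - x')
    linarith
  have hi := h.FF_int ha ham hξ.1
  have hi' := h.FF_int ha ham hξ'.1
  have g1 := aux_gronwall (fun s => ‖ξ s - ξ' s‖) ((hξ.1.sub hξ'.1).norm)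
    (‖x - x'‖ + 2 * K * |t - t'|) (2 * L) m (by positivity) hm0 ?_ (fun s => norm_nonneg _)
    (by positivity)
  · refine g1.trans ?_
    have : 2 * (2 * L) * m ≤ 4 * L * t := by nlinarith
    gcongr
  · intro s hs
    have e1 : ξ s = ξ m + ∫ τ in m..s, FF c v a ξ τ := by
      rw [hξ.2 s ⟨hs.1, hs.2.trans hmt⟩, hξ.2 m ⟨hm0, hmt⟩, add_assoc,
        intervalIntegral.integral_add_adjacent_intervals (hi _ _) (hi _ _)]
    have e2 : ξ' s = ξ' m + ∫ τ in m..s, FF c v a ξ' τ := by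
      rw [hξ'.2 s ⟨hs.1, hs.2.trans hmt'⟩, hξ'.2 m ⟨hm0, hmt'⟩, add_assoc,
        intervalIntegral.integral_add_adjacent_intervals (hi' _ _) (hi' _ _)]
    have e3 : ξ s - ξ' s = (ξ m - ξ' m) - ∫ τ in s..m, (FF c v a ξ τ - FF c v a ξ' τ) := by
      rw [intervalIntegral.integral_sub (hi _ _) (hi' _ _), e1, e2,
        intervalIntegral.integral_symm s m, intervalIntegral.integral_symm s m]
      abel
    have e4 : ‖∫ τ in s..m, (FF c v a ξ τ - FF c v a ξ' τ)‖ ≤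
        ∫ τ in s..m, 2 * L * ‖ξ τ - ξ' τ‖ :=
      intervalIntegral.norm_integral_le_of_norm_le hs.2
        (Eventually.of_forall fun τ _ => h.FF_lip ha _ _ τ)
        ((continuous_const.mul (hξ.1.sub hξ'.1).norm).intervalIntegrable _ _)
    rw [intervalIntegral.integral_const_mul] at e4
    show ‖ξ s - ξ' s‖ ≤ _
    rw [e3]
    exact (norm_sub_le _ _).trans (add_le_add hA e4)

lemma RegPair.transfer (h : RegPair c v K L) {t t' : ℝ} (ht' : 0 ≤ t')
    {x y : Euc d} (x' : Euc d) (hr : Reachable c v 0 y t x) :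
    ∃ y', Reachable c v 0 y' t' x' ∧
      ‖y - y'‖ ≤ 2 * (‖x - x'‖ + 2 * K * |t - t'|) * Real.exp (4 * L * t) := by
  obtain ⟨a, ha, ham, ξ, hξ, rfl⟩ := h.reach_traj hr
  obtain ⟨ξ', hξ'⟩ := h.exists_traj ha ham ht' x'
  exact ⟨ξ' 0, h.traj_reach ha ham ht' hξ', h.compare ha ham hr.1 ht' hξ hξ'⟩

end

theorem control_representation_uniformly_continuous
    {d : ℕ} (c : ℝ → Euc d → ℝ) (v : ℝ → Euc d → Euc d)
    (hc0 : ∀ t x, 0 ≤ c t x)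
    (K : ℝ) (hbdd : ∀ t x, c t x ≤ K ∧ ‖v t x‖ ≤ K)
    (L : ℝ) (hlip : ∀ t : ℝ, ∀ x x' : Euc d,
      |c t x - c t x'| ≤ L * ‖x - x'‖ ∧ ‖v t x - v t x'‖ ≤ L * ‖x - x'‖)
    (huct : ∀ ε : ℝ, 0 < ε → ∃ δ : ℝ, 0 < δ ∧ ∀ t t' : ℝ, |t - t'| ≤ δ → ∀ x : Euc d,
      |c t x - c t' x| ≤ ε ∧ ‖v t x - v t' x‖ ≤ ε)
    (u0 : Euc d → ℝ) (hu0 : UniformContinuous u0)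
    (u : ℝ → Euc d → ℝ)
    (hu : ∀ t x, u t x = sSup {r | ∃ y : Euc d, r = u0 y ∧ x ∈ reachSet c v t 0 y}) :
    (∀ t : ℝ, 0 ≤ t → ∀ x : Euc d,
      {r | ∃ y : Euc d, r = u0 y ∧ x ∈ reachSet c v t 0 y}.Nonempty ∧
      BddAbove {r | ∃ y : Euc d, r = u0 y ∧ x ∈ reachSet c v t 0 y}) ∧
    ∀ T : ℝ, 0 < T →
      UniformContinuousOn (fun p : ℝ × Euc d => u p.1 p.2) (Set.Icc 0 T ×ˢ Set.univ) := by
  have hle : ∀ x x' : Euc d, L * ‖x - x'‖ ≤ (|L| + 1) * ‖x - x'‖ := fun x x' => by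
    gcongr; linarith [le_abs_self L]
  have hLp : 0 < |L| + 1 := by positivity
  have hK : 0 ≤ K := (norm_nonneg _).trans (hbdd 0 0).2
  have h : RegPair c v K (|L| + 1) := by
    refine ⟨hc0, fun t x => (hbdd t x).1, fun t x => (hbdd t x).2, hLp,
      fun t x x' => (hlip t x x').1.trans (hle _ _), fun t x x' => (hlip t x x').2.trans (hle _ _),
      ?_, ?_⟩
    · refine continuous_prod_of_continuous_lipschitzWith' _ (Real.toNNReal (|L| + 1)) ?_ ?_
      · intro t
        refine LipschitzWith.of_dist_le_mul fun x x' => ?_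
        rw [Real.coe_toNNReal _ hLp.le, dist_eq_norm, dist_eq_norm]
        exact (hlip t x x').1.trans (hle _ _)
      · intro x
        rw [Metric.continuous_iff]
        intro t ε hε
        obtain ⟨δ, hδ, H⟩ := huct (ε / 2) (by positivity)
        refine ⟨δ, hδ, fun t' ht' => ?_⟩
        rw [Real.dist_eq] at ht' ⊢
        have := (H t' t ht'.le x).1
        exact this.trans_lt (by linarith)
    · refine continuous_prod_of_continuous_lipschitzWith' _ (Real.toNNReal (|L| + 1)) ?_ ?_
      · intro t
        refine LipschitzWith.of_dist_le_mul fun x x' => ?_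
        rw [Real.coe_toNNReal _ hLp.le, dist_eq_norm, dist_eq_norm]
        exact (hlip t x x').2.trans (hle _ _)
      · intro x
        rw [Metric.continuous_iff]
        intro t ε hε
        obtain ⟨δ, hδ, H⟩ := huct (ε / 2) (by positivity)
        refine ⟨δ, hδ, fun t' ht' => ?_⟩
        rw [Real.dist_eq] at ht'
        rw [dist_eq_norm]
        have := (H t' t ht'.le x).2
        exact this.trans_lt (by linarith)
  have hmem : ∀ t x y, x ∈ reachSet c v t 0 y ↔ Reachable c v 0 y t x := by
    intro t x y; simp [reachSet]
  simp only [hmem] at hu ⊢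
  have hfirst : ∀ t : ℝ, 0 ≤ t → ∀ x : Euc d,
      {r | ∃ y : Euc d, r = u0 y ∧ Reachable c v 0 y t x}.Nonempty ∧
      BddAbove {r | ∃ y : Euc d, r = u0 y ∧ Reachable c v 0 y t x} := by
    intro t ht x
    constructor
    · have ha : ∀ s : ℝ, ‖(fun _ => 0 : ℝ → Euc d) s‖ ≤ 1 := by simp
      obtain ⟨ξ, hξ⟩ := h.exists_traj ha aestronglyMeasurable_const ht x
      exact ⟨_, ξ 0, rfl, h.traj_reach ha aestronglyMeasurable_const ht hξ⟩
    · obtain ⟨B, hB⟩ := (isCompact_closedBall x (2 * K * t)).bddAbove_image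
        hu0.continuous.continuousOn
      refine ⟨B, ?_⟩
      rintro r ⟨y, rfl, hy⟩
      obtain ⟨a, ha, ham, ξ, hξ, rfl⟩ := h.reach_traj hy
      apply hB
      refine ⟨_, ?_, rfl⟩
      rw [mem_closedBall, dist_eq_norm]
      simpa using h.traj_dist ha hξ (s := 0) ⟨le_rfl, ht⟩
  refine ⟨hfirst, fun T hT => ?_⟩
  rw [Metric.uniformContinuousOn_iff]
  intro ε hε
  obtain ⟨δ, hδ, H⟩ := Metric.uniformContinuous_iff.1 hu0 (ε / 2) (by positivity)
  set C := 2 * (1 + 2 * K) * Real.exp (4 * (|L| + 1) * T) with hC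
  have hCpos : 0 < C := by positivity
  have main : ∀ t ∈ Set.Icc 0 T, ∀ t' ∈ Set.Icc 0 T, ∀ x x' : Euc d,
      ‖x - x'‖ < δ / C → |t - t'| < δ / C → u t x ≤ u t' x' + ε / 2 := by
    intro t ht t' ht' x x' hx htt
    rw [hu t x]
    refine csSup_le (hfirst t ht.1 x).1 ?_
    rintro r ⟨y, rfl, hy⟩
    obtain ⟨y', hy', hd⟩ := h.transfer ht'.1 x' hy
    have hlt : dist y y' < δ := by
      rw [dist_eq_norm]
      calc ‖y - y'‖ ≤ _ := hd
        _ ≤ 2 * (‖x - x'‖ + 2 * K * |t - t'|) * Real.exp (4 * (|L| + 1) * T) := by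
          gcongr; exact ht.2
        _ < 2 * (δ / C + 2 * K * (δ / C)) * Real.exp (4 * (|L| + 1) * T) := by
          gcongr ?_ * _
          have : 2 * K * |t - t'| ≤ 2 * K * (δ / C) := by gcongr
          linarith
        _ = C * (δ / C) := by rw [hC]; ring
        _ = δ := by field_simp
    have h1 := H hlt
    rw [Real.dist_eq] at h1
    have h2 : u0 y' ≤ u t' x' := by
      rw [hu t' x']
      exact le_csSup (hfirst t' ht'.1 x').2 ⟨y', rfl, hy'⟩
    linarith [(abs_lt.1 h1).2]
  refine ⟨δ / C, by positivity, ?_⟩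
  rintro ⟨t, x⟩ ⟨ht, -⟩ ⟨t', x'⟩ ⟨ht', -⟩ hd
  rw [Prod.dist_eq, max_lt_iff] at hd
  obtain ⟨hd1, hd2⟩ := hd
  simp only [Real.dist_eq, dist_eq_norm] at hd1 hd2 ht ht' ⊢
  have m1 := main t ht t' ht' x x' hd2 hd1
  have m2 := main t' ht' t ht x' x (by rwa [norm_sub_rev]) (by rwa [abs_sub_comm])
  rw [Real.norm_eq_abs, abs_lt]
  constructor <;> linarith
end
end
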